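/- arXiv:math/0510606 — 7 statements merged into one kernel-verified Lean document; each statement's English description precedes it below -/
import Mathlib

section
/- Let a, b : ℝ → ℝ be measurable 2π-periodic functions with 0 < ess-inf a ≤ ess-sup a < ∞ and 0 < ess-inf b ≤ ess-sup b < ∞. Let w : ℝ → ℝ be a 2π-periodic locally absolutely continuous function with w' ∈ L²(0, 2π) satisfying the constraint ∫₀^{2π} a(t) w(t) dt = 0. Then ∫₀^{2π} a w² ≤ C · ∫₀^{2π} b (w')², where C = ( [ (1/(2π)) ∫₀^{2π} √(a(t)/b(t)) dt ] / [ (4/π) · arctan( (ess-inf(ab)/ess-sup(ab))^{1/4} ) ] )². -/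
open MeasureTheory Real Set intervalIntegral

noncomputable section

lemma hasDerivAt_ite_le {f g : ℝ → ℝ} {d x a : ℝ} (hf : x ≤ a → HasDerivAt f d x)
    (hg : a ≤ x → HasDerivAt g d x) (h : f a = g a) :
    HasDerivAt (fun t => if t ≤ a then f t else g t) d x := by
  rcases lt_trichotomy x a with hx | rfl | hx
  · refine (hf hx.le).congr_of_eventuallyEq ?_
    filter_upwards [Iio_mem_nhds hx] with t ht
    simp [(mem_Iio.1 ht).le]
  · rw [← hasDerivWithinAt_univ, ← Iic_union_Ici (a := x)]
    refine ((hf le_rfl).hasDerivWithinAt.congr (fun t ht => ?_) ?_).union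
      ((hg le_rfl).hasDerivWithinAt.congr (fun t ht => ?_) ?_)
    · simp [mem_Iic.1 ht]
    · simp
    · rcases (mem_Ici.1 ht).eq_or_lt with rfl | h'
      · simpa using h
      · simp [h']
    · simpa using h
  · refine (hg hx.le).congr_of_eventuallyEq ?_
    filter_upwards [Ioi_mem_nhds hx] with t ht
    simp [mem_Ioi.1 ht]

lemma hasDerivAt_const_mul_tan_add {p c x : ℝ} (hp : p ≠ 0) (hx : x + c ∈ Ioo (-(π / 2)) (π / 2)) :
    HasDerivAt (fun t => p * tan (t + c)) ((p * tan (x + c)) ^ 2 / p + p) x := by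
  have hc : cos (x + c) ≠ 0 := (cos_pos_of_mem_Ioo hx).ne'
  have h := (((hasDerivAt_tan hc).comp x ((hasDerivAt_id x).add_const c)).const_mul p)
  refine h.congr_deriv ?_
  rw [mul_one, one_div, ← inv_one_add_tan_sq hc, inv_inv]
  field_simp
  ring

/-- The solution of the extremal Riccati equation `G' = max (G² / m + m) (G² / M + M)`. -/
lemma exists_hasDerivAt_riccati {m M : ℝ} (hm : 0 < m) (hmM : m ≤ M) :
    ∃ G : ℝ → ℝ, ∀ x ∈ Ioo (-(2 * arctan √(m / M))) (2 * arctan √(m / M)),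
      HasDerivAt G (max (G x ^ 2 / m + m) (G x ^ 2 / M + M)) x := by
  have hM : 0 < M := hm.trans_le hmM
  set k := √(m / M) with hk
  have hk0 : 0 < k := by positivity
  have hk2 : k ^ 2 = m / M := sq_sqrt (by positivity)
  have hk1 : k ≤ 1 := sqrt_le_one.2 ((div_le_one hM).2 hmM)
  set A := arctan k with hA
  have hA0 : 0 < A := arctan_pos.2 hk0
  have hA4 : A ≤ π / 4 := arctan_one ▸ arctan_strictMono.monotone hk1
  have htA : tan A = k := tan_arctan k
  have hpi := pi_pos
  have hmk : m * k⁻¹ = M * k := by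
    field_simp
    rw [hk2]; field_simp
  have hmax₁ : ∀ v : ℝ, v ^ 2 ≤ m * M → max (v ^ 2 / m + m) (v ^ 2 / M + M) = v ^ 2 / M + M := by
    intro v hv
    refine max_eq_right (sub_nonneg.1 ?_)
    have : v ^ 2 / M + M - (v ^ 2 / m + m) = (m * M - v ^ 2) * (M - m) / (m * M) := by
      field_simp; ring
    rw [this]
    exact div_nonneg (mul_nonneg (by linarith) (by linarith)) (by positivity)
  have hmax₂ : ∀ v : ℝ, m * M ≤ v ^ 2 → max (v ^ 2 / m + m) (v ^ 2 / M + M) = v ^ 2 / m + m := by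
    intro v hv
    refine max_eq_left (sub_nonneg.1 ?_)
    have : v ^ 2 / m + m - (v ^ 2 / M + M) = (v ^ 2 - m * M) * (M - m) / (m * M) := by
      field_simp; ring
    rw [this]
    exact div_nonneg (mul_nonneg (by linarith) (by linarith)) (by positivity)
  have hsq : (M * k) ^ 2 = m * M := by rw [mul_pow, hk2]; field_simp
  have htan : tan (A + (π / 2 - 2 * A)) = k⁻¹ := by
    rw [show A + (π / 2 - 2 * A) = π / 2 - A by ring, tan_pi_div_two_sub, htA]
  have htan' : tan (-A + -(π / 2 - 2 * A)) = -k⁻¹ := by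
    rw [← neg_add, tan_neg, htan]
  refine ⟨fun t => if t ≤ -A then m * tan (t + -(π / 2 - 2 * A)) else
    (fun t => if t ≤ A then M * tan (t + 0) else m * tan (t + (π / 2 - 2 * A))) t, ?_⟩
  rintro x ⟨hx₁, hx₂⟩
  have glue₁ : m * tan (-A + -(π / 2 - 2 * A)) = M * tan (-A + 0) := by
    rw [htan', add_zero, tan_neg, htA]; linarith
  have glue₂ : M * tan (A + 0) = m * tan (A + (π / 2 - 2 * A)) := by
    rw [htan, add_zero, htA]; linarith
  have mono : ∀ {y z : ℝ}, -(π / 2) < y → z < π / 2 → y ≤ z → tan y ≤ tan z := by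
    intro y z hy hz hyz
    exact strictMonoOn_tan.monotoneOn ⟨hy, hyz.trans_lt hz⟩ ⟨hy.trans_le hyz, hz⟩ hyz
  refine hasDerivAt_ite_le (fun hx => ?_) (fun hx => hasDerivAt_ite_le (fun hx' => ?_)
    (fun hx' => ?_) glue₂) ?_
  · have h1 : tan (x + -(π / 2 - 2 * A)) ≤ -k⁻¹ :=
      htan' ▸ mono (by linarith) (by linarith) (by linarith)
    simp only [hx, if_true]
    rw [hmax₂]
    · exact hasDerivAt_const_mul_tan_add hm.ne' ⟨by linarith, by linarith⟩
    · have : m * tan (x + -(π / 2 - 2 * A)) ≤ -(M * k) := by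
        rw [← hmk]; nlinarith
      have : 0 < M * k := by positivity
      nlinarith
  · have h1 : tan (x + 0) ≤ k := htA ▸ mono (by linarith) (by linarith) (by linarith)
    have h2 : -k ≤ tan (x + 0) := by
      rw [← htA, ← tan_neg]; exact mono (by linarith) (by linarith) (by linarith)
    have hG : (if x ≤ -A then m * tan (x + -(π / 2 - 2 * A)) else
        (if x ≤ A then M * tan (x + 0) else m * tan (x + (π / 2 - 2 * A)))) =
        M * tan (x + 0) := by
      rcases hx.eq_or_lt with rfl | h
      · rw [if_pos le_rfl, glue₁]
      · rw [if_neg (not_le.2 h), if_pos hx']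
    simp only [hG]
    rw [hmax₁]
    · exact hasDerivAt_const_mul_tan_add hM.ne' ⟨by linarith, by linarith⟩
    · rw [← hsq, mul_pow, mul_pow]
      exact mul_le_mul_of_nonneg_left (sq_le_sq' h2 h1) (by positivity)
  · have h1 : k⁻¹ ≤ tan (x + (π / 2 - 2 * A)) :=
      htan ▸ mono (by linarith) (by linarith) (by linarith)
    have hG : (if x ≤ -A then m * tan (x + -(π / 2 - 2 * A)) else
        (if x ≤ A then M * tan (x + 0) else m * tan (x + (π / 2 - 2 * A)))) =
        m * tan (x + (π / 2 - 2 * A)) := by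
      rw [if_neg (by linarith)]
      rcases hx'.eq_or_lt with rfl | h
      · rw [if_pos le_rfl, glue₂]
      · rw [if_neg (not_le.2 h)]
    simp only [hG]
    rw [hmax₂]
    · exact hasDerivAt_const_mul_tan_add hm.ne' ⟨by linarith, by linarith⟩
    · have : M * k ≤ m * tan (x + (π / 2 - 2 * A)) := by
        rw [← hmk]; exact mul_le_mul_of_nonneg_left h1 hm.le
      have : 0 < M * k := by positivity
      nlinarith
  · rw [if_pos (by linarith), glue₁]

lemma sq_div_add_le_max {m M p : ℝ} (v : ℝ) (hm : 0 < m) (hp : p ∈ Icc m M) :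
    v ^ 2 / p + p ≤ max (v ^ 2 / m + m) (v ^ 2 / M + M) := by
  obtain ⟨h1, h2⟩ := hp
  have hp : 0 < p := hm.trans_le h1
  have hM : 0 < M := hp.trans_le h2
  rw [le_max_iff]
  rcases le_total (v ^ 2) (p * M) with h | h
  · right
    rw [← sub_nonneg, show v ^ 2 / M + M - (v ^ 2 / p + p) = (p * M - v ^ 2) * (M - p) / (p * M) by
      field_simp; ring]
    exact div_nonneg (mul_nonneg (by linarith) (by linarith)) (by positivity)
  · left
    have : p * m ≤ v ^ 2 := by nlinarith
    rw [← sub_nonneg, show v ^ 2 / m + m - (v ^ 2 / p + p) = (v ^ 2 - p * m) * (p - m) / (p * m) by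
      field_simp; ring]
    exact div_nonneg (mul_nonneg (by linarith) (by linarith)) (by positivity)

/-- A subsolution `Q` of the Riccati equation bounds the energy of `u` from below. -/
lemma riccati_energy_le {a b u u' Q Q' : ℝ → ℝ} {x y l : ℝ} (hxy : x ≤ y)
    (hQ : AbsolutelyContinuousOnInterval Q x y) (hu : AbsolutelyContinuousOnInterval u x y)
    (hu' : ∀ᵐ t, HasDerivAt u (u' t) t)
    (hQ' : ∀ᵐ t, t ∈ Icc x y → HasDerivAt Q (Q' t) t)
    (hb : ∀ᵐ t, 0 < b t)
    (hineq : ∀ᵐ t, t ∈ Icc x y → Q' t + Q t ^ 2 / b t + l * a t ≤ 0)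
    (hbi : IntervalIntegrable (fun t => b t * u' t ^ 2) volume x y)
    (hai : IntervalIntegrable (fun t => a t * u t ^ 2) volume x y) :
    Q y * u y ^ 2 - Q x * u x ^ 2 ≤
      (∫ t in x..y, b t * u' t ^ 2) - l * ∫ t in x..y, a t * u t ^ 2 := by
  have hac : AbsolutelyContinuousOnInterval (fun t => Q t * (u t * u t)) x y :=
    hQ.fun_mul (hu.fun_mul hu)
  have h := hac.integral_deriv_eq_sub
  have hE := hbi.sub (hai.const_mul l)
  calc Q y * u y ^ 2 - Q x * u x ^ 2 = ∫ t in x..y, deriv (fun t => Q t * (u t * u t)) t := by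
        rw [h]; ring
    _ ≤ ∫ t in x..y, (b t * u' t ^ 2 - l * (a t * u t ^ 2)) := by
        refine integral_mono_ae_restrict hxy hac.intervalIntegrable_deriv hE ?_
        refine (ae_restrict_iff' measurableSet_Icc).2 ?_
        filter_upwards [hu', hQ', hb, hineq] with t h1 h2 h3 h4 ht
        have h2 := h2 ht
        have h4 := h4 ht
        have hd := h2.mul (h1.mul h1)
        have hd' : deriv (fun t => Q t * (u t * u t)) t = _ := hd.deriv
        rw [hd']
        have key : b t * u' t ^ 2 - 2 * Q t * u t * u' t + Q t ^ 2 / b t * u t ^ 2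
            = b t * (u' t - Q t * u t / b t) ^ 2 := by field_simp; ring
        have key2 : 0 ≤ b t * (u' t - Q t * u t / b t) ^ 2 := by positivity
        have key3 := mul_nonpos_of_nonpos_of_nonneg h4 (sq_nonneg (u t))
        simp only [Pi.mul_apply]
        nlinarith
    _ = _ := by
        rw [intervalIntegral.integral_sub hbi (hai.const_mul l), intervalIntegral.integral_const_mul]

lemma riccati_comp_energy_le {a b S G u u' : ℝ → ℝ} {m M D d κ c x y : ℝ} {K : NNReal}
    (hm : 0 < m)
    (hG : ∀ τ ∈ Ioo (-D) D, HasDerivAt G (max (G τ ^ 2 / m + m) (G τ ^ 2 / M + M)) τ)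
    (hd : d < D) (hS : LipschitzWith K S) (hS' : ∀ᵐ t, HasDerivAt S √(a t / b t) t)
    (hpos : ∀ᵐ t, 0 < a t ∧ 0 < b t)
    (hab : ∀ᵐ t, t ∈ Icc x y → √(a t * b t) ∈ Icc m M)
    (hr : ∀ t ∈ Icc x y, κ * (c - S t) ∈ Icc (-d) d) (hxy : x ≤ y)
    (hu : AbsolutelyContinuousOnInterval u x y) (hu' : ∀ᵐ t, HasDerivAt u (u' t) t)
    (hbi : IntervalIntegrable (fun t => b t * u' t ^ 2) volume x y)
    (hai : IntervalIntegrable (fun t => a t * u t ^ 2) volume x y) :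
    κ * G (κ * (c - S y)) * u y ^ 2 - κ * G (κ * (c - S x)) * u x ^ 2 ≤
      (∫ t in x..y, b t * u' t ^ 2) - κ ^ 2 * ∫ t in x..y, a t * u t ^ 2 := by
  have hsub : Icc (-d) d ⊆ Ioo (-D) D := fun τ hτ => ⟨by linarith [hτ.1], by linarith [hτ.2]⟩
  have hGc : ContinuousOn G (Icc (-d) d) := fun τ hτ =>
    (hG τ (hsub hτ)).continuousAt.continuousWithinAt
  have hGc' : ContinuousOn (fun τ => max (G τ ^ 2 / m + m) (G τ ^ 2 / M + M)) (Icc (-d) d) := by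
    fun_prop
  obtain ⟨B, hB⟩ := isCompact_Icc.exists_bound_of_continuousOn hGc'
  have hGL : LipschitzOnWith B.toNNReal G (Icc (-d) d) :=
    (convex_Icc _ _).lipschitzOnWith_of_nnnorm_hasDerivWithin_le
      (fun τ hτ => (hG τ (hsub hτ)).hasDerivWithinAt)
      (fun τ hτ => by
        rw [← NNReal.coe_le_coe]
        exact (hB τ hτ).trans (le_coe_toNNReal B))
  have hQ : AbsolutelyContinuousOnInterval (fun t => κ * G (κ * (c - S t))) x y := by
    refine AbsolutelyContinuousOnInterval.const_mul κ ?_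
    have hin : LipschitzWith (‖κ‖₊ * (0 + K)) (fun t => κ * (c - S t)) :=
      (lipschitzWith_smul κ).comp ((LipschitzWith.const c).sub hS)
    refine (hGL.comp (hin.lipschitzOnWith (s := uIcc x y)) ?_).absolutelyContinuousOnInterval
    rw [uIcc_of_le hxy]
    exact hr
  refine riccati_energy_le (Q' := fun t => κ * ((max (G (κ * (c - S t)) ^ 2 / m + m)
    (G (κ * (c - S t)) ^ 2 / M + M)) * (κ * -√(a t / b t)))) hxy hQ hu hu' ?_
    (hpos.mono fun t h => h.2) ?_ hbi hai
  · filter_upwards [hS'] with t ht htx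
    exact ((hG _ (hsub (hr t htx))).comp t ((ht.const_sub c).const_mul κ)).const_mul κ
  · filter_upwards [hpos, hab] with t ⟨h1, h2⟩ h3 htx
    have h4 := sq_div_add_le_max (G (κ * (c - S t))) hm (h3 htx)
    have hp : √(a t * b t) = √(a t / b t) * b t := by
      rw [sqrt_eq_iff_eq_sq (by positivity) (by positivity), mul_pow, sq_sqrt (by positivity)]
      field_simp
    have hr0 : 0 < √(a t / b t) := by positivity
    have hra : √(a t / b t) ^ 2 * b t = a t := by
      rw [sq_sqrt (by positivity)]; field_simp
    rw [hp] at h4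
    generalize √(a t / b t) = r at *
    generalize max (G (κ * (c - S t)) ^ 2 / m + m) (G (κ * (c - S t)) ^ 2 / M + M) = N at *
    generalize G (κ * (c - S t)) = g at *
    have h5 := mul_le_mul_of_nonneg_left h4 hr0.le
    have h6 : r * (g ^ 2 / (r * b t) + r * b t) = g ^ 2 / b t + a t := by
      rw [← hra]; field_simp
    rw [h6] at h5
    have h7 := mul_le_mul_of_nonneg_left h5 (sq_nonneg κ)
    have h8 : (κ * g) ^ 2 / b t = κ ^ 2 * (g ^ 2 / b t) := by ring
    rw [h8]
    linarith

/-- A closed curve takes equal values at two points that halve its length. -/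
lemma exists_eq_of_half_length {S w : ℝ → ℝ} {T : ℝ} (hSm : StrictMono S)
    (hsurj : Function.Surjective S) (hw : Continuous w) (h0 : S 0 = 0) (hT : 0 ≤ S T)
    (hwT : w 0 = w T) :
    ∃ x y, 0 ≤ x ∧ x ≤ y ∧ y ≤ T ∧ S y = S x + S T / 2 ∧ w x = w y := by
  let e := hSm.orderIsoOfSurjective S hsurj
  have he : ∀ s, S (e.symm s) = s := fun s => e.apply_symm_apply s
  have he' : ∀ t, e.symm (S t) = t := fun t => e.symm_apply_apply t
  have hW : Continuous fun s => w (e.symm (s + S T / 2)) - w (e.symm s) := by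
    have := e.symm.continuous
    fun_prop
  have hW0 : w (e.symm (S T / 2 + S T / 2)) - w (e.symm (S T / 2)) =
      -(w (e.symm (0 + S T / 2)) - w (e.symm 0)) := by
    have h := he' 0
    rw [h0] at h
    rw [add_halves, he', h, zero_add, hwT]; ring
  have hz : (0 : ℝ) ∈ uIcc (w (e.symm (0 + S T / 2)) - w (e.symm 0))
      (w (e.symm (S T / 2 + S T / 2)) - w (e.symm (S T / 2))) := by
    rw [hW0, mem_uIcc]
    rcases le_total 0 (w (e.symm (0 + S T / 2)) - w (e.symm 0)) with h | h
    · exact Or.inr ⟨by linarith, h⟩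
    · exact Or.inl ⟨h, by linarith⟩
  obtain ⟨s, hs, hs0⟩ := intermediate_value_uIcc hW.continuousOn hz
  rw [uIcc_of_le (by linarith)] at hs
  refine ⟨e.symm s, e.symm (s + S T / 2), ?_, ?_, ?_, ?_, by simp only at hs0; linarith⟩
  · rw [← hSm.le_iff_le, he, h0]; exact hs.1
  · rw [← hSm.le_iff_le, he, he]; linarith
  · rw [← hSm.le_iff_le, he]; linarith [hs.2]
  · rw [he, he]

/-- The eigenvalue bound for the weighted problem on a circle of optical length `∫ √(a / b)`. -/
lemma exists_sq_mul_integral_sub_le {a b w w' : ℝ → ℝ} {T m M c₁ C₁ c₂ C₂ : ℝ} (hT : 0 < T)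
    (ha : Measurable a) (hb : Measurable b) (hc₁ : 0 < c₁) (hc₂ : 0 < c₂)
    (haB : ∀ᵐ t, c₁ ≤ a t ∧ a t ≤ C₁) (hbB : ∀ᵐ t, c₂ ≤ b t ∧ b t ≤ C₂)
    (hm : 0 < m) (hmM : m ≤ M) (hab : ∀ᵐ t, t ∈ Icc 0 T → √(a t * b t) ∈ Icc m M)
    (hw : Continuous w) (hwac : AbsolutelyContinuousOnInterval w 0 T)
    (hw' : ∀ᵐ t, HasDerivAt w (w' t) t) (hwT : w 0 = w T)
    (hbi : IntervalIntegrable (fun t => b t * w' t ^ 2) volume 0 T) :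
    0 < (∫ t in (0 : ℝ)..T, √(a t / b t)) ∧
    ∃ c, (8 * arctan √(m / M) / ∫ t in (0 : ℝ)..T, √(a t / b t)) ^ 2 *
      (∫ t in (0 : ℝ)..T, a t * (w t - c) ^ 2) ≤ ∫ t in (0 : ℝ)..T, b t * w' t ^ 2 := by
  have hrm : Measurable fun t => √(a t / b t) := (ha.div hb).sqrt
  have hr : ∀ᵐ t, √(c₁ / C₂) ≤ √(a t / b t) ∧ √(a t / b t) ≤ √(C₁ / c₂) := by
    filter_upwards [haB, hbB] with t h1 h2
    have hbt : 0 < b t := hc₂.trans_le h2.1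
    have hat : 0 < a t := hc₁.trans_le h1.1
    exact ⟨sqrt_le_sqrt (div_le_div₀ hat.le h1.1 hbt h2.2),
      sqrt_le_sqrt (div_le_div₀ (hat.le.trans h1.2) h1.2 hc₂ h2.1)⟩
  have hpos : ∀ᵐ t, 0 < a t ∧ 0 < b t := by
    filter_upwards [haB, hbB] with t h1 h2 using ⟨hc₁.trans_le h1.1, hc₂.trans_le h2.1⟩
  have hC₂ : 0 < C₂ := by
    obtain ⟨t, ht⟩ := hbB.exists
    linarith
  have hε : 0 < √(c₁ / C₂) := by positivity
  have hrloc : LocallyIntegrable fun t => √(a t / b t) := by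
    refine (locallyIntegrable_const √(C₁ / c₂)).mono hrm.aestronglyMeasurable ?_
    filter_upwards [hr] with t ht
    rw [norm_of_nonneg (sqrt_nonneg _), norm_of_nonneg (sqrt_nonneg _)]
    exact ht.2
  have hri : ∀ x y, IntervalIntegrable (fun t => √(a t / b t)) volume x y := fun x y =>
    (hrloc.integrableOn_isCompact isCompact_uIcc).intervalIntegrable
  set S : ℝ → ℝ := fun t => ∫ s in (0 : ℝ)..t, √(a s / b s) with hSdef
  have hSsub : ∀ x y, S y - S x = ∫ s in x..y, √(a s / b s) := fun x y =>
    integral_interval_sub_left (hri 0 y) (hri 0 x)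
  have hS0 : S 0 = 0 := integral_same
  have hS' : ∀ᵐ t, HasDerivAt S √(a t / b t) t := by
    filter_upwards [LocallyIntegrable.ae_hasDerivAt_integral hrloc] with t ht using ht 0
  have hSL : LipschitzWith (√(C₁ / c₂)).toNNReal S := by
    refine LipschitzWith.of_dist_le_mul fun x y => ?_
    rw [dist_eq_norm, hSsub, coe_toNNReal _ (sqrt_nonneg _), dist_eq_norm]
    refine norm_integral_le_of_norm_le_const_ae ?_
    filter_upwards [hr] with t ht _
    rw [norm_of_nonneg (sqrt_nonneg _)]
    exact ht.2
  have hSlow : ∀ x y, x ≤ y → √(c₁ / C₂) * (y - x) ≤ S y - S x := by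
    intro x y hxy
    rw [hSsub]
    calc √(c₁ / C₂) * (y - x) = ∫ _ in x..y, √(c₁ / C₂) := by simp [mul_comm]
      _ ≤ _ := integral_mono_ae hxy intervalIntegrable_const (hri x y) (hr.mono fun t ht => ht.1)
  have hSm : StrictMono S := fun x y hxy => by
    have := hSlow x y hxy.le
    have := mul_pos hε (sub_pos.2 hxy)
    linarith
  have hSc : Continuous S := hSL.continuous
  have hsurj : Function.Surjective S := by
    refine hSc.surjective ?_ ?_
    · refine Filter.tendsto_atTop_mono' _ ?_ (Filter.tendsto_id.const_mul_atTop hε)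
      filter_upwards [Filter.eventually_ge_atTop 0] with t ht
      have := hSlow 0 t ht
      simp only [id]; linarith
    · refine Filter.tendsto_atBot_mono' _ ?_ (Filter.tendsto_id.const_mul_atBot hε)
      filter_upwards [Filter.eventually_le_atBot 0] with t ht
      have := hSlow t 0 ht
      simp only [id]; linarith
  have hL : 0 < S T := hS0 ▸ hSm hT
  refine ⟨hL, ?_⟩
  obtain ⟨x, y, hx, hxy, hyT, hSy, hwxy⟩ :=
    exists_eq_of_half_length hSm hsurj hw hS0 hL.le hwT
  change ∃ c, (8 * arctan √(m / M) / S T) ^ 2 * _ ≤ _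
  refine ⟨w x, ?_⟩
  have hM : 0 < M := hm.trans_le hmM
  set A := arctan √(m / M) with hA
  have hA0 : 0 < A := arctan_pos.2 (by positivity)
  obtain ⟨G, hG⟩ := exists_hasDerivAt_riccati hm hmM
  set u : ℝ → ℝ := fun t => w t - w x with hu
  have huc : Continuous u := by fun_prop
  have huac : AbsolutelyContinuousOnInterval u 0 T :=
    hwac.sub (LipschitzOnWith.absolutelyContinuousOnInterval
      ((LipschitzWith.const (w x)).lipschitzOnWith))
  have hu' : ∀ᵐ t, HasDerivAt u (w' t) t := hw'.mono fun t ht => ht.sub_const _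
  have hai : IntervalIntegrable (fun t => a t * u t ^ 2) volume 0 T := by
    have : LocallyIntegrable a := by
      refine (locallyIntegrable_const C₁).mono ha.aestronglyMeasurable ?_
      filter_upwards [haB] with t ht
      rw [norm_of_nonneg (hc₁.le.trans ht.1), norm_of_nonneg (hc₁.le.trans (ht.1.trans ht.2))]
      exact ht.2
    exact (this.integrableOn_isCompact isCompact_uIcc).intervalIntegrable.mul_continuousOn
      (huc.pow 2).continuousOn
  have hyx : S y = S x + S T / 2 := hSy
  have hSxT : S x ≤ S T / 2 := by
    have := hSm.monotone hyT
    linarith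
  have hSx0 : 0 ≤ S x := hS0 ▸ hSm.monotone hx
  have hux : u x = 0 := sub_self _
  have huy : u y = 0 := sub_eq_zero.2 hwxy.symm
  have huT : u T = u 0 := by simp only [hu, hwT]
  have key : ∀ κ ∈ Ioo 0 (8 * A / S T),
      κ ^ 2 * (∫ t in (0 : ℝ)..T, a t * u t ^ 2) ≤ ∫ t in (0 : ℝ)..T, b t * w' t ^ 2 := by
    rintro κ ⟨hκ0, hκ⟩
    have hd : κ * (S T / 4) < 2 * A := by
      rw [lt_div_iff₀ hL] at hκ
      linarith
    have piece : ∀ p q c, 0 ≤ p → p ≤ q → q ≤ T → c - S T / 4 ≤ S p → S q ≤ c + S T / 4 →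
        κ * G (κ * (c - S q)) * u q ^ 2 - κ * G (κ * (c - S p)) * u p ^ 2 ≤
          (∫ t in p..q, b t * w' t ^ 2) - κ ^ 2 * ∫ t in p..q, a t * u t ^ 2 := by
      intro p q c hp hpq hq h1 h2
      have hsub : uIcc p q ⊆ uIcc 0 T := by
        rw [uIcc_of_le hpq, uIcc_of_le hT.le]
        exact Icc_subset_Icc hp hq
      refine riccati_comp_energy_le hm hG hd hSL hS' hpos ?_ ?_ hpq (huac.mono hsub) hu'
        (hbi.mono_set hsub) (hai.mono_set hsub)
      · filter_upwards [hab] with t ht htpq using ht ⟨hp.trans htpq.1, htpq.2.trans hq⟩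
      · intro t ht
        have h3 := hSm.monotone ht.1
        have h4 := hSm.monotone ht.2
        rw [← mul_neg]
        exact ⟨mul_le_mul_of_nonneg_left (by linarith) hκ0.le,
          mul_le_mul_of_nonneg_left (by linarith) hκ0.le⟩
    have p1 := piece 0 x (S x - S T / 4) le_rfl hx (hxy.trans hyT) (by linarith) (by linarith)
    have p2 := piece x y (S x + S T / 4) hx hxy hyT (by linarith) (by linarith)
    have p3 := piece y T (S x - S T / 4 + S T) (hx.trans hxy) hyT le_rfl (by linarith)
      (by linarith)
    have hsplit : ∀ f : ℝ → ℝ, IntervalIntegrable f volume 0 T →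
        (∫ t in (0 : ℝ)..x, f t) + (∫ t in x..y, f t) + (∫ t in y..T, f t) =
          ∫ t in (0 : ℝ)..T, f t := by
      intro f hf
      have hsub : ∀ {p q}, 0 ≤ p → p ≤ q → q ≤ T → IntervalIntegrable f volume p q := by
        intro p q hp hpq hq
        refine hf.mono_set ?_
        rw [uIcc_of_le hpq, uIcc_of_le hT.le]
        exact Icc_subset_Icc hp hq
      rw [integral_add_adjacent_intervals (hsub le_rfl hx (hxy.trans hyT)) (hsub hx hxy hyT),
        integral_add_adjacent_intervals (hsub le_rfl (hx.trans hxy) hyT)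
          (hsub (hx.trans hxy) hyT le_rfl)]
    rw [← hsplit _ hai, ← hsplit _ hbi]
    rw [hux] at p1
    rw [hux, huy] at p2
    rw [huy, huT, show S x - S T / 4 + S T - S T = S x - S T / 4 - S 0 by rw [hS0]; ring] at p3
    nlinarith
  have hcl : 8 * A / S T ∈ closure (Ioo 0 (8 * A / S T)) := by
    rw [closure_Ioo (by positivity)]
    exact right_mem_Icc.2 (by positivity)
  exact closure_minimal (t := {κ : ℝ | κ ^ 2 * (∫ t in (0 : ℝ)..T, a t * u t ^ 2) ≤
    ∫ t in (0 : ℝ)..T, b t * w' t ^ 2}) key (isClosed_le (by fun_prop) continuous_const) hcl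

/-- weighted Wirtinger inequality.
If `a, b` are measurable `2π`-periodic weights, essentially bounded above and below by
positive constants, and `w` is a `2π`-periodic locally absolutely continuous function
(with derivative `w' ∈ L²(0,2π)`) satisfying `∫₀^{2π} a w = 0`, then
`∫₀^{2π} a w² ≤ C ∫₀^{2π} b (w')²` with
`C = ( ((1/2π) ∫₀^{2π} √(a/b)) / ((4/π) arctan ((essinf(ab)/esssup(ab))^{1/4})) )²`. -/
theorem stmt1 (a b : ℝ → ℝ) (ha : Measurable a) (hb : Measurable b)
    (hap : Function.Periodic a (2 * π)) (hbp : Function.Periodic b (2 * π))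
    (ha_bdd : ∃ c C : ℝ, 0 < c ∧ ∀ᵐ t : ℝ, c ≤ a t ∧ a t ≤ C)
    (hb_bdd : ∃ c C : ℝ, 0 < c ∧ ∀ᵐ t : ℝ, c ≤ b t ∧ b t ≤ C)
    (w w' : ℝ → ℝ) (hwp : Function.Periodic w (2 * π))
    (hw'loc : LocallyIntegrable w')
    (hac : ∀ s t : ℝ, w t = w s + ∫ r in s..t, w' r)
    (hw'L2 : IntegrableOn (fun t => (w' t) ^ 2) (Ioc 0 (2 * π)))
    (hconstraint : (∫ t in (0 : ℝ)..(2 * π), a t * w t) = 0) :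
    (∫ t in (0 : ℝ)..(2 * π), a t * (w t) ^ 2) ≤
      (((1 / (2 * π)) * ∫ t in (0 : ℝ)..(2 * π), Real.sqrt (a t / b t)) /
          ((4 / π) * arctan
            ((essInf (fun t => a t * b t) (volume.restrict (Ioc 0 (2 * π))) /
                essSup (fun t => a t * b t) (volume.restrict (Ioc 0 (2 * π)))) ^
              ((1 : ℝ) / 4)))) ^ 2 *
        ∫ t in (0 : ℝ)..(2 * π), b t * (w' t) ^ 2 := by
  have hπ : (0 : ℝ) < 2 * π := by positivity
  obtain ⟨c₁, C₁, hc₁, haB⟩ := ha_bdd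
  obtain ⟨c₂, C₂, hc₂, hbB⟩ := hb_bdd
  have hwi : ∀ x y, IntervalIntegrable w' volume x y := fun x y =>
    (hw'loc.integrableOn_isCompact isCompact_uIcc).intervalIntegrable
  have hweq : w = fun t => w 0 + ∫ r in (0 : ℝ)..t, w' r := funext fun t => hac 0 t
  have hw : Continuous w := by
    rw [hweq]
    exact continuous_const.add (continuous_primitive hwi 0)
  have hwac : AbsolutelyContinuousOnInterval w 0 (2 * π) := by
    rw [hweq]
    exact (LipschitzOnWith.absolutelyContinuousOnInterval
      ((LipschitzWith.const (w 0)).lipschitzOnWith)).fun_add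
      ((hwi 0 (2 * π)).absolutelyContinuousOnInterval_intervalIntegral (by simp))
  have hwd : ∀ᵐ t, HasDerivAt w (w' t) t := by
    filter_upwards [LocallyIntegrable.ae_hasDerivAt_integral hw'loc] with t ht
    rw [hweq]
    exact (ht 0).const_add _
  have hwT : w 0 = w (2 * π) := by simpa using (hwp 0).symm
  have hbi : IntervalIntegrable (fun t => b t * w' t ^ 2) volume 0 (2 * π) := by
    rw [intervalIntegrable_iff_integrableOn_Ioc_of_le hπ.le]
    refine Integrable.bdd_mul (c := C₂) hw'L2 hb.aestronglyMeasurable ?_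
    filter_upwards [ae_restrict_of_ae hbB] with t ht
    rw [norm_of_nonneg (hc₂.le.trans ht.1)]
    exact ht.2
  have hai : IntervalIntegrable a volume 0 (2 * π) := by
    rw [intervalIntegrable_iff_integrableOn_Ioc_of_le hπ.le]
    refine Integrable.of_bound ha.aestronglyMeasurable C₁ ?_
    filter_upwards [ae_restrict_of_ae haB] with t ht
    rw [norm_of_nonneg (hc₁.le.trans ht.1)]
    exact ht.2
  set μ := volume.restrict (Ioc 0 (2 * π)) with hμ
  have : NeZero μ := ⟨by simp [hμ, pi_pos]⟩
  set i := essInf (fun t => a t * b t) μ with hi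
  set s := essSup (fun t => a t * b t) μ with hs
  have hlow : ∀ᵐ t ∂μ, c₁ * c₂ ≤ a t * b t := by
    filter_upwards [ae_restrict_of_ae haB, ae_restrict_of_ae hbB] with t h1 h2
    exact mul_le_mul h1.1 h2.1 hc₂.le (hc₁.le.trans h1.1)
  have hup : ∀ᵐ t ∂μ, a t * b t ≤ C₁ * C₂ := by
    filter_upwards [ae_restrict_of_ae haB, ae_restrict_of_ae hbB] with t h1 h2
    exact mul_le_mul h1.2 h2.2 (hc₂.le.trans h2.1) (hc₁.le.trans (h1.1.trans h1.2))
  have hbelow : Filter.IsBoundedUnder (· ≥ ·) (ae μ) fun t => a t * b t := ⟨_, hlow⟩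
  have habove : Filter.IsBoundedUnder (· ≤ ·) (ae μ) fun t => a t * b t := ⟨_, hup⟩
  have hi0 : 0 < i := (mul_pos hc₁ hc₂).trans_le
    (le_essInf_of_ae_le _ hlow habove.isCoboundedUnder_ge)
  have hile : ∀ᵐ t ∂μ, i ≤ a t * b t := ae_essInf_le hbelow
  have hles : ∀ᵐ t ∂μ, a t * b t ≤ s := ae_le_essSup habove
  have his : i ≤ s := by
    obtain ⟨t, h1, h2⟩ := (hile.and hles).exists
    exact h1.trans h2
  have hs0 : 0 < s := hi0.trans_le his
  have hab : ∀ᵐ t, t ∈ Icc 0 (2 * π) → √(a t * b t) ∈ Icc √i √s := by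
    rw [← ae_restrict_iff' measurableSet_Icc, ← restrict_Ioc_eq_restrict_Icc]
    filter_upwards [hile, hles] with t h1 h2 using ⟨sqrt_le_sqrt h1, sqrt_le_sqrt h2⟩
  obtain ⟨hL, c, hc⟩ := exists_sq_mul_integral_sub_le hπ ha hb hc₁ hc₂ haB hbB (sqrt_pos.2 hi0)
    (sqrt_le_sqrt his) hab hw hwac hwd hwT hbi
  have hk : (i / s) ^ ((1 : ℝ) / 4) = √(√i / √s) := by
    rw [← sqrt_div hi0.le, sqrt_eq_rpow, sqrt_eq_rpow, ← rpow_mul (by positivity)]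
    norm_num
  rw [hk]
  have hA : 0 < arctan √(√i / √s) := arctan_pos.2 (by positivity)
  set L := ∫ t in (0 : ℝ)..(2 * π), √(a t / b t) with hLdef
  set A := arctan √(√i / √s) with hAdef
  have hC : (1 / (2 * π) * L / (4 / π * A)) ^ 2 = ((8 * A / L) ^ 2)⁻¹ := by
    field_simp
    norm_num
  rw [hC, ← div_eq_inv_mul, le_div_iff₀ (by positivity), mul_comm]
  refine le_trans (mul_le_mul_of_nonneg_left ?_ (by positivity)) hc
  have haw : IntervalIntegrable (fun t => a t * w t) volume 0 (2 * π) :=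
    hai.mul_continuousOn hw.continuousOn
  have haw2 : IntervalIntegrable (fun t => a t * w t ^ 2) volume 0 (2 * π) :=
    hai.mul_continuousOn (hw.pow 2).continuousOn
  have hexp : (∫ t in (0 : ℝ)..(2 * π), a t * (w t - c) ^ 2) =
      (∫ t in (0 : ℝ)..(2 * π), a t * w t ^ 2) + c ^ 2 * ∫ t in (0 : ℝ)..(2 * π), a t := by
    calc _ = ∫ t in (0 : ℝ)..(2 * π), (a t * w t ^ 2 - 2 * c * (a t * w t) + c ^ 2 * a t) := by
          congr 1; ext t; ring
      _ = _ := by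
          rw [intervalIntegral.integral_add (haw2.sub (haw.const_mul _)) (hai.const_mul _),
            intervalIntegral.integral_sub haw2 (haw.const_mul _),
            intervalIntegral.integral_const_mul, intervalIntegral.integral_const_mul, hconstraint]
          ring
  have hapos : 0 ≤ ∫ t in (0 : ℝ)..(2 * π), a t :=
    integral_nonneg_of_ae hπ.le (haB.mono fun t ht => hc₁.le.trans ht.1)
  rw [hexp]
  nlinarith [mul_nonneg (sq_nonneg c) hapos]
end
end

section
/- Let k₁, k₂ : ℝ → ℝ be positive, bounded, measurable 2π-periodic functions with positive essential lower bounds, let γ > 0, and for x ∈ ℝ² \ {0} define A(x) = J(arg x) · diag(k₁(arg x), k₂(arg x)) · J(arg x)^T, where J(t) is the rotation matrix with rows (cos t, −sin t) and (sin t, cos t). Suppose Θ : ℝ → ℝ is a 2π-periodic locally absolutely continuous function with Θ' ∈ L²(0,2π) that is a weak solution of −(k₂ Θ')' = γ² k₁ Θ on ℝ, i.e. ∫₀^{2π} k₂ Θ' ψ' = γ² ∫₀^{2π} k₁ Θ ψ for all ψ ∈ C_c^∞(0, 2π) extended 2π-periodically (equivalently for all smooth 2π-periodic ψ). Then the function u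 : ℝ² → ℝ defined by u(x) = |x|^γ Θ(arg x) for x ≠ 0 and u(0) = 0 is a weak solution of div(A ∇u) = 0 in the unit disk B₁(0): u ∈ H¹(B₁(0)) and ∫_{B₁(0)} ⟨A ∇u, ∇φ⟩ = 0 for all φ ∈ C_c^∞(B₁(0)). -/
open MeasureTheory Real Set Matrix intervalIntegral
open scoped Classical

noncomputable section

abbrev V2 := EuclideanSpace ℝ (Fin 2)

def toV (v : Fin 2 → ℝ) : V2 := (WithLp.equiv 2 (Fin 2 → ℝ)).symm v

def dot2 (v w : Fin 2 → ℝ) : ℝ := v 0 * w 0 + v 1 * w 1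

/-- The angular polar coordinate `arg y ∈ [0, 2π)` of `y ∈ ℝ²` (with `arg 0 = 0`). -/
def arg2 (x : V2) : ℝ :=
  if 0 ≤ Complex.arg (Complex.mk (x 0) (x 1)) then Complex.arg (Complex.mk (x 0) (x 1))
  else Complex.arg (Complex.mk (x 0) (x 1)) + 2 * π

/-- The rotation matrix `J(t)`. -/
def Jmat (t : ℝ) : Matrix (Fin 2) (Fin 2) ℝ :=
  !![Real.cos t, -Real.sin t; Real.sin t, Real.cos t]

/-- The matrix `A(y) = J(arg y) diag(k₁(arg y), k₂(arg y)) J(arg y)ᵀ`. -/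
def Amat (k1 k2 : ℝ → ℝ) (y : V2) : Matrix (Fin 2) (Fin 2) ℝ :=
  Jmat (arg2 y) * Matrix.diagonal ![k1 (arg2 y), k2 (arg2 y)] * (Jmat (arg2 y))ᵀ

def gradf (φ : V2 → ℝ) (x : V2) : Fin 2 → ℝ := fun i => fderiv ℝ φ x (toV (Pi.single i 1))

/-- `g` is the weak gradient of `u` on `Ω`. -/
def IsWeakGradient (Ω : Set V2) (u : V2 → ℝ) (g : V2 → Fin 2 → ℝ) : Prop :=
  ∀ φ : V2 → ℝ, ContDiff ℝ (⊤ : ℕ∞) φ → HasCompactSupport φ → tsupport φ ⊆ Ω →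
    ∀ i : Fin 2, (∫ x in Ω, u x * gradf φ x i) = - ∫ x in Ω, g x i * φ x

/-- Polar coordinates `(r, θ) ↦ (r cos θ, r sin θ)` on the plane. -/
def polarMap (p : ℝ × ℝ) : V2 := toV ![p.1 * Real.cos p.2, p.1 * Real.sin p.2]

/-- The open rectangle `(0, 1) × (0, 2π)` of polar coordinates of the unit disk. -/
def polarRect : Set (ℝ × ℝ) := Ioo 0 1 ×ˢ Ioo 0 (2 * π)

lemma measurableSet_polarRect : MeasurableSet polarRect :=
  measurableSet_Ioo.prod measurableSet_Ioo

lemma polarMap_zero_apply (p : ℝ × ℝ) : polarMap p 0 = p.1 * Real.cos p.2 := rfl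

lemma polarMap_one_apply (p : ℝ × ℝ) : polarMap p 1 = p.1 * Real.sin p.2 := rfl

lemma norm_polarMap {p : ℝ × ℝ} (hp : 0 ≤ p.1) : ‖polarMap p‖ = p.1 := by
  rw [EuclideanSpace.norm_eq, Fin.sum_univ_two, polarMap_zero_apply, polarMap_one_apply]
  simp only [Real.norm_eq_abs, sq_abs]
  rw [show (p.1 * Real.cos p.2) ^ 2 + (p.1 * Real.sin p.2) ^ 2 = p.1 ^ 2 by
    linear_combination p.1 ^ 2 * Real.sin_sq_add_cos_sq p.2]
  exact Real.sqrt_sq hp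

lemma polarMap_ne_zero {p : ℝ × ℝ} (hp : 0 < p.1) : polarMap p ≠ 0 := by
  rw [← norm_pos_iff, norm_polarMap hp.le]
  exact hp

lemma arg2_polarMap {p : ℝ × ℝ} (hp : 0 < p.1) (h0 : 0 < p.2) (h1 : p.2 < 2 * π) :
    arg2 (polarMap p) = p.2 := by
  have key (t : ℝ) (hc : Real.cos t = Real.cos p.2) (hs : Real.sin t = Real.sin p.2) :
      Complex.mk (polarMap p 0) (polarMap p 1) =
        (p.1 : ℂ) * (Complex.cos t + Complex.sin t * Complex.I) := by
    rw [polarMap_zero_apply, polarMap_one_apply, ← hc, ← hs, ← Complex.ofReal_cos,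
      ← Complex.ofReal_sin]
    apply Complex.ext <;> simp [-Complex.ofReal_cos, -Complex.ofReal_sin]
  rcases le_or_gt p.2 π with h | h
  · have h2 := key p.2 rfl rfl
    unfold arg2
    rw [h2, Complex.arg_mul_cos_add_sin_mul_I hp ⟨by linarith [Real.pi_pos], h⟩, if_pos h0.le]
  · have h2 := key (p.2 - 2 * π) (Real.cos_sub_two_pi _) (Real.sin_sub_two_pi _)
    unfold arg2
    rw [h2, Complex.arg_mul_cos_add_sin_mul_I hp ⟨by linarith, by linarith⟩,
      if_neg (by linarith)]
    ring

lemma injOn_polarCoord_symm_polarRect : InjOn polarCoord.symm polarRect := by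
  intro p hp q hq h
  have h' : polarMap p = polarMap q := by
    have h1 := congrArg Prod.fst h
    have h2 := congrArg Prod.snd h
    simp only [polarCoord_symm_apply] at h1 h2
    simp only [polarMap, h1, h2]
  ext
  · rw [← norm_polarMap hp.1.1.le, h', norm_polarMap hq.1.1.le]
  · rw [← arg2_polarMap hp.1.1 hp.2.1 hp.2.2, h', arg2_polarMap hq.1.1 hq.2.1 hq.2.2]

/-- The identification of the Euclidean plane with `ℝ × ℝ`. -/
def planeEquiv : V2 ≃ᵐ ℝ × ℝ :=
  (MeasurableEquiv.toLp 2 (Fin 2 → ℝ)).symm.trans MeasurableEquiv.finTwoArrow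

lemma planeEquiv_symm_polarCoord_symm (p : ℝ × ℝ) :
    planeEquiv.symm (polarCoord.symm p) = polarMap p := by
  rw [MeasurableEquiv.symm_apply_eq]
  rfl

lemma measurePreserving_planeEquiv : MeasurePreserving planeEquiv :=
  (volume_preserving_finTwoArrow ℝ).comp
    (EuclideanSpace.volume_preserving_symm_measurableEquiv_toLp (Fin 2))

lemma image_polarRect_ae_eq :
    polarCoord.symm '' polarRect =ᵐ[volume] planeEquiv.symm ⁻¹' (Metric.ball (0 : V2) 1) := by
  have hsub : polarCoord.symm '' polarRect ⊆ planeEquiv.symm ⁻¹' (Metric.ball (0 : V2) 1) := by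
    rintro _ ⟨p, hp, rfl⟩
    rw [mem_preimage, planeEquiv_symm_polarCoord_symm, mem_ball_zero_iff,
      norm_polarMap hp.1.1.le]
    exact hp.1.2
  refine (hsub.eventuallyLE).antisymm ?_
  have h0 : ∀ᵐ q : ℝ × ℝ, -q ∈ polarCoord.source := by
    have h1 : ∀ᵐ q : ℝ × ℝ, q ∈ polarCoord.source := by
      filter_upwards [polarCoord_source_ae_eq_univ] with q hq
      exact (iff_of_eq hq).2 trivial
    exact (Measure.measurePreserving_neg (volume : Measure (ℝ × ℝ))).quasiMeasurePreserving.ae h1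
  filter_upwards [h0] with q hq hball
  have ht := polarCoord.map_source hq
  have hl := polarCoord.left_inv hq
  set t := polarCoord (-q)
  have hr : (0 : ℝ) < t.1 := ht.1
  have e : polarCoord.symm (t.1, t.2 + π) = q := by
    rw [← neg_inj, ← hl]
    simp [polarCoord_symm_apply, Real.cos_add_pi, Real.sin_add_pi]
  refine ⟨(t.1, t.2 + π), ⟨⟨hr, ?_⟩, ?_, ?_⟩, e⟩
  · have hb : planeEquiv.symm q ∈ Metric.ball (0 : V2) 1 := hball
    rwa [← e, planeEquiv_symm_polarCoord_symm, mem_ball_zero_iff, 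
      norm_polarMap (p := (t.1, t.2 + π)) hr.le] at hb
  · have := ht.2.1
    simp only
    linarith
  · have := ht.2.2
    simp only
    linarith

/-- Integration over the unit disk in polar coordinates. -/
lemma setIntegral_ball_eq_polar (F : V2 → ℝ) :
    ∫ x in Metric.ball (0 : V2) 1, F x = ∫ p in polarRect, p.1 * F (polarMap p) := by
  rw [← (measurePreserving_planeEquiv.symm planeEquiv).setIntegral_preimage_emb
    planeEquiv.symm.measurableEmbedding, ← setIntegral_congr_set image_polarRect_ae_eq,
    integral_image_eq_integral_abs_det_fderiv_smul volume measurableSet_polarRect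
      (fun p _ => (hasFDerivAt_polarCoord_symm p).hasFDerivWithinAt)
      injOn_polarCoord_symm_polarRect]
  refine setIntegral_congr_fun measurableSet_polarRect fun p hp => ?_
  simp only [det_fderivPolarCoordSymm, planeEquiv_symm_polarCoord_symm, abs_of_pos hp.1.1,
    smul_eq_mul]

/-- Integrability over the unit disk in polar coordinates. -/
lemma integrableOn_ball_iff_polar (F : V2 → ℝ) :
    IntegrableOn F (Metric.ball (0 : V2) 1) ↔
      IntegrableOn (fun p => p.1 * F (polarMap p)) polarRect := by
  rw [← (measurePreserving_planeEquiv.symm planeEquiv).integrableOn_comp_preimage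
    planeEquiv.symm.measurableEmbedding, ← integrableOn_congr_set_ae image_polarRect_ae_eq,
    integrableOn_image_iff_integrableOn_abs_det_fderiv_smul volume measurableSet_polarRect
      (fun p _ => (hasFDerivAt_polarCoord_symm p).hasFDerivWithinAt)
      injOn_polarCoord_symm_polarRect]
  refine integrableOn_congr_fun (fun p hp => ?_) measurableSet_polarRect
  simp only [det_fderivPolarCoordSymm, Function.comp_apply, planeEquiv_symm_polarCoord_symm,
    abs_of_pos hp.1.1, smul_eq_mul]

lemma toV_eq_sum (v : Fin 2 → ℝ) :
    toV v = v 0 • toV (Pi.single 0 1) + v 1 • toV (Pi.single 1 1) := by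
  ext i
  fin_cases i <;> simp [toV]

/-- The radial derivative of `φ` at the point with polar coordinates `p`. -/
def radialDeriv (φ : V2 → ℝ) (p : ℝ × ℝ) : ℝ :=
  Real.cos p.2 * gradf φ (polarMap p) 0 + Real.sin p.2 * gradf φ (polarMap p) 1

/-- The derivative of `φ` in the unit angular direction at the point with polar coordinates `p`. -/
def tangentialDeriv (φ : V2 → ℝ) (p : ℝ × ℝ) : ℝ :=
  -Real.sin p.2 * gradf φ (polarMap p) 0 + Real.cos p.2 * gradf φ (polarMap p) 1

lemma contDiff_toV : ContDiff ℝ (⊤ : ℕ∞) toV :=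
  (PiLp.continuousLinearEquiv 2 ℝ (fun _ : Fin 2 => ℝ)).symm.contDiff

lemma contDiff_polarMap : ContDiff ℝ (⊤ : ℕ∞) polarMap := by
  refine contDiff_toV.comp (contDiff_pi.2 fun i => ?_)
  fin_cases i
  · exact contDiff_fst.mul (Real.contDiff_cos.comp contDiff_snd)
  · exact contDiff_fst.mul (Real.contDiff_sin.comp contDiff_snd)

lemma hasDerivAt_toV {v : ℝ → Fin 2 → ℝ} {v' : Fin 2 → ℝ} {t : ℝ} (h : HasDerivAt v v' t) :
    HasDerivAt (fun s => toV (v s)) (toV v') t :=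
  (PiLp.continuousLinearEquiv 2 ℝ (fun _ : Fin 2 => ℝ)).symm.hasFDerivAt.comp_hasDerivAt t h

lemma hasDerivAt_vec2 {a b : ℝ → ℝ} {a' b' t : ℝ} (ha : HasDerivAt a a' t)
    (hb : HasDerivAt b b' t) : HasDerivAt (fun s => ![a s, b s]) ![a', b'] t := by
  rw [hasDerivAt_pi]
  intro i
  fin_cases i
  · exact ha
  · exact hb

lemma fderiv_toV (φ : V2 → ℝ) (x : V2) (v : Fin 2 → ℝ) :
    fderiv ℝ φ x (toV v) = v 0 * gradf φ x 0 + v 1 * gradf φ x 1 := by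
  rw [toV_eq_sum, map_add, map_smul, map_smul]
  rfl

lemma hasDerivAt_comp_polarMap_fst {φ : V2 → ℝ} (hφ : Differentiable ℝ φ) (r θ : ℝ) :
    HasDerivAt (fun s => φ (polarMap (s, θ))) (radialDeriv φ (r, θ)) r := by
  have h := hasDerivAt_toV (hasDerivAt_vec2 ((hasDerivAt_id r).mul_const (Real.cos θ))
    ((hasDerivAt_id r).mul_const (Real.sin θ)))
  have h2 := (hφ (polarMap (r, θ))).hasFDerivAt.comp_hasDerivAt r h
  rw [fderiv_toV] at h2
  exact h2.congr_deriv (by simp [radialDeriv])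

lemma hasDerivAt_comp_polarMap_snd {φ : V2 → ℝ} (hφ : Differentiable ℝ φ) (r θ : ℝ) :
    HasDerivAt (fun t => φ (polarMap (r, t))) (r * tangentialDeriv φ (r, θ)) θ := by
  have h := hasDerivAt_toV (hasDerivAt_vec2 ((Real.hasDerivAt_cos θ).const_mul r)
    ((Real.hasDerivAt_sin θ).const_mul r))
  have h2 := (hφ (polarMap (r, θ))).hasFDerivAt.comp_hasDerivAt θ h
  rw [fderiv_toV] at h2
  refine h2.congr_deriv ?_
  simp only [tangentialDeriv, Matrix.cons_val_zero, Matrix.cons_val_one]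
  ring

lemma continuous_gradf {φ : V2 → ℝ} (hφ : ContDiff ℝ (⊤ : ℕ∞) φ) (i : Fin 2) :
    Continuous fun x => gradf φ x i :=
  (hφ.continuous_fderiv (by simp)).clm_apply continuous_const

lemma exists_bound_gradf {φ : V2 → ℝ} (hφ : ContDiff ℝ (⊤ : ℕ∞) φ) (hc : HasCompactSupport φ) :
    ∃ C, ∀ x i, |gradf φ x i| ≤ C := by
  have h (i : Fin 2) : ∃ C, ∀ x, |gradf φ x i| ≤ C :=
    (hc.fderiv_apply ℝ _).exists_bound_of_continuous (continuous_gradf hφ i)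
  choose C hC using h
  refine ⟨max (C 0) (C 1), fun x i => (hC i x).trans ?_⟩
  fin_cases i
  · exact le_max_left _ _
  · exact le_max_right _ _

lemma continuous_radialDeriv {φ : V2 → ℝ} (hφ : ContDiff ℝ (⊤ : ℕ∞) φ) :
    Continuous (radialDeriv φ) := by
  have h0 := (continuous_gradf hφ 0).comp contDiff_polarMap.continuous
  have h1 := (continuous_gradf hφ 1).comp contDiff_polarMap.continuous
  exact ((Real.continuous_cos.comp continuous_snd).mul h0).add
    ((Real.continuous_sin.comp continuous_snd).mul h1)

lemma continuous_tangentialDeriv {φ : V2 → ℝ} (hφ : ContDiff ℝ (⊤ : ℕ∞) φ) :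
    Continuous (tangentialDeriv φ) := by
  have h0 := (continuous_gradf hφ 0).comp contDiff_polarMap.continuous
  have h1 := (continuous_gradf hφ 1).comp contDiff_polarMap.continuous
  exact ((Real.continuous_sin.comp continuous_snd).neg.mul h0).add
    ((Real.continuous_cos.comp continuous_snd).mul h1)

lemma abs_mul_add_mul_le {a b x y C : ℝ} (ha : |a| ≤ 1) (hb : |b| ≤ 1) (hx : |x| ≤ C)
    (hy : |y| ≤ C) : |a * x + b * y| ≤ 2 * C := by
  have h1 := mul_le_mul ha hx (abs_nonneg x) zero_le_one
  have h2 := mul_le_mul hb hy (abs_nonneg y) zero_le_one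
  calc |a * x + b * y| ≤ |a * x| + |b * y| := abs_add_le _ _
    _ ≤ 2 * C := by rw [abs_mul, abs_mul]; linarith

lemma exists_bound_radialDeriv {φ : V2 → ℝ} (hφ : ContDiff ℝ (⊤ : ℕ∞) φ)
    (hc : HasCompactSupport φ) : ∃ C, ∀ p, |radialDeriv φ p| ≤ C := by
  obtain ⟨C, hC⟩ := exists_bound_gradf hφ hc
  exact ⟨2 * C, fun p => abs_mul_add_mul_le (Real.abs_cos_le_one _) (Real.abs_sin_le_one _)
    (hC _ _) (hC _ _)⟩

lemma exists_bound_tangentialDeriv {φ : V2 → ℝ} (hφ : ContDiff ℝ (⊤ : ℕ∞) φ)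
    (hc : HasCompactSupport φ) : ∃ C, ∀ p, |tangentialDeriv φ p| ≤ C := by
  obtain ⟨C, hC⟩ := exists_bound_gradf hφ hc
  exact ⟨2 * C, fun p => abs_mul_add_mul_le (by rw [abs_neg]; exact Real.abs_sin_le_one _)
    (Real.abs_cos_le_one _) (hC _ _) (hC _ _)⟩

/-- A product of integrable functions of `r` and of `θ` times a bounded continuous function is
integrable over the polar rectangle. -/
lemma integrableOn_polarRect_mul {f h : ℝ → ℝ} {b : ℝ × ℝ → ℝ} (hf : IntegrableOn f (Ioo 0 1))
    (hh : IntegrableOn h (Ioo 0 (2 * π))) (hb : Continuous b) (hbd : ∃ C, ∀ p, |b p| ≤ C) :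
    IntegrableOn (fun p => f p.1 * h p.2 * b p) polarRect := by
  obtain ⟨C, hC⟩ := hbd
  have h1 : IntegrableOn (fun p : ℝ × ℝ => f p.1 * h p.2) polarRect := by
    rw [IntegrableOn, polarRect, Measure.volume_eq_prod, ← Measure.prod_restrict]
    exact Integrable.mul_prod hf hh
  exact Integrable.mul_bdd h1 hb.aestronglyMeasurable (Filter.Eventually.of_forall hC)

lemma setIntegral_polarRect {H : ℝ × ℝ → ℝ} (hH : IntegrableOn H polarRect) :
    ∫ p in polarRect, H p = ∫ r in Ioo 0 1, ∫ θ in Ioo 0 (2 * π), H (r, θ) := by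
  rw [Measure.volume_eq_prod] at hH ⊢
  exact setIntegral_prod H hH

lemma setIntegral_polarRect_swap {H : ℝ × ℝ → ℝ} (hH : IntegrableOn H polarRect) :
    ∫ p in polarRect, H p = ∫ θ in Ioo 0 (2 * π), ∫ r in Ioo 0 1, H (r, θ) := by
  rw [setIntegral_polarRect hH]
  refine integral_integral_swap ?_
  rw [IntegrableOn, polarRect, Measure.volume_eq_prod, ← Measure.prod_restrict] at hH
  exact hH

lemma integrableOn_rpow_Ioo {s : ℝ} (hs : -1 < s) : IntegrableOn (fun r : ℝ => r ^ s) (Ioo 0 1) :=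
  (integrableOn_Ioo_rpow_iff one_pos).2 hs

/-- Integration by parts in the radial variable. -/
lemma integral_rpow_mul_deriv {α : ℝ} (hα : 0 < α) {η η' : ℝ → ℝ}
    (hη : ∀ r, HasDerivAt η (η' r) r) (hη' : Continuous η') (h1 : η 1 = 0) :
    ∫ r in Ioo (0 : ℝ) 1, r ^ α * η' r = -α * ∫ r in Ioo (0 : ℝ) 1, r ^ (α - 1) * η r := by
  have h := integral_mul_deriv_eq_deriv_mul_of_hasDerivAt (a := 0) (b := 1)
    (u := fun r : ℝ => r ^ α) (u' := fun r => α * r ^ (α - 1)) (v := η) (v' := η')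
    (Real.continuous_rpow_const hα.le).continuousOn
    (fun x _ => (hη x).continuousAt.continuousWithinAt)
    (fun x hx => Real.hasDerivAt_rpow_const (Or.inl (by
      rw [min_eq_left zero_le_one] at hx; exact hx.1.ne')))
    (fun x _ => hη x)
    ((intervalIntegral.intervalIntegrable_rpow' (by linarith)).const_mul α)
    (hη'.intervalIntegrable _ _)
  simp only [h1, Real.zero_rpow hα.ne', mul_zero, zero_mul, sub_zero, zero_sub] at h
  rw [intervalIntegral.integral_of_le zero_le_one, intervalIntegral.integral_of_le zero_le_one,
    integral_Ioc_eq_integral_Ioo, integral_Ioc_eq_integral_Ioo] at h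
  rw [h, neg_mul, ← MeasureTheory.integral_const_mul]
  simp only [mul_assoc]

/-- Integration by parts over one period against an absolutely continuous periodic function. -/
lemma integral_mul_deriv_of_primitive {Θ Θ' η : ℝ → ℝ} (hΘper : Function.Periodic Θ (2 * π))
    (hΘ'loc : LocallyIntegrable Θ') (hac : ∀ s t : ℝ, Θ t = Θ s + ∫ r in s..t, Θ' r)
    (hη : ContDiff ℝ (⊤ : ℕ∞) η) (hηper : Function.Periodic η (2 * π)) :
    ∫ t in Ioo 0 (2 * π), Θ t * deriv η t = -∫ t in Ioo 0 (2 * π), Θ' t * η t := by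
  have hpi : (0 : ℝ) ≤ 2 * π := by positivity
  have hint : IntervalIntegrable Θ' volume 0 (2 * π) :=
    intervalIntegrable_iff.2
      ((hΘ'loc.integrableOn_isCompact isCompact_uIcc).mono_set uIoc_subset_uIcc)
  have hΘ : Θ = fun t => Θ 0 + ∫ r in (0 : ℝ)..t, Θ' r := funext fun t => hac 0 t
  have hd : ∀ᵐ t : ℝ, deriv Θ t = Θ' t := by
    filter_upwards [LocallyIntegrable.ae_hasDerivAt_integral hΘ'loc] with t ht
    rw [hΘ]
    exact ((ht 0).const_add _).deriv
  have hΘac : AbsolutelyContinuousOnInterval Θ 0 (2 * π) := by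
    rw [hΘ]
    refine AbsolutelyContinuousOnInterval.add ?_
      (hint.absolutelyContinuousOnInterval_intervalIntegral (by simp))
    exact contDiffOn_const.absolutelyContinuousOnInterval
  have h := hΘac.integral_mul_deriv_eq_deriv_mul
    ((hη.of_le (by simp)).contDiffOn.absolutelyContinuousOnInterval)
  have e1 : Θ (2 * π) = Θ 0 := by simpa using hΘper 0
  have e2 : η (2 * π) = η 0 := by simpa using hηper 0
  rw [e1, e2, sub_self, zero_sub, intervalIntegral.integral_of_le hpi,
    intervalIntegral.integral_of_le hpi, integral_Ioc_eq_integral_Ioo,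
    integral_Ioc_eq_integral_Ioo] at h
  rw [h]
  congr 1
  refine integral_congr_ae (ae_restrict_of_ae ?_)
  filter_upwards [hd] with t ht
  rw [ht]

lemma eq_zero_of_tsupport_subset_ball {φ : V2 → ℝ} (hs : tsupport φ ⊆ Metric.ball (0 : V2) 1)
    {x : V2} (hx : 1 ≤ ‖x‖) : φ x = 0 := by
  by_contra h
  have := hs (subset_tsupport φ h)
  rw [mem_ball_zero_iff] at this
  linarith

lemma exists_bound_comp_polarMap {φ : V2 → ℝ} (hφ : ContDiff ℝ (⊤ : ℕ∞) φ)
    (hc : HasCompactSupport φ) : ∃ C, ∀ p, |φ (polarMap p)| ≤ C := by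
  obtain ⟨C, hC⟩ := hc.exists_bound_of_continuous hφ.continuous
  exact ⟨C, fun p => hC _⟩

lemma continuous_comp_polarMap {φ : V2 → ℝ} (hφ : ContDiff ℝ (⊤ : ℕ∞) φ) :
    Continuous fun p => φ (polarMap p) :=
  hφ.continuous.comp contDiff_polarMap.continuous

lemma continuous_of_primitive {Θ Θ' : ℝ → ℝ} (hΘ'loc : LocallyIntegrable Θ')
    (hac : ∀ s t : ℝ, Θ t = Θ s + ∫ r in s..t, Θ' r) : Continuous Θ := by
  rw [show Θ = fun t => Θ 0 + ∫ r in (0 : ℝ)..t, Θ' r from funext fun t => hac 0 t]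
  exact continuous_const.add (intervalIntegral.continuous_primitive
    (fun a b => intervalIntegrable_iff.2
      ((hΘ'loc.integrableOn_isCompact isCompact_uIcc).mono_set uIoc_subset_uIcc)) 0)

lemma integrableOn_Ioo_of_continuous {w : ℝ → ℝ} (hw : Continuous w) (a b : ℝ) :
    IntegrableOn w (Ioo a b) :=
  hw.integrableOn_Icc.mono_set Ioo_subset_Icc_self

lemma integrableOn_Ioo_mul_continuous {v w : ℝ → ℝ} (hv : LocallyIntegrable v)
    (hw : Continuous w) (a b : ℝ) : IntegrableOn (fun t => v t * w t) (Ioo a b) :=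
  ((hv.integrableOn_isCompact isCompact_Icc).mul_continuousOn hw.continuousOn
    isCompact_Icc).mono_set Ioo_subset_Icc_self

/-- Integration by parts in the radial variable over the polar rectangle. -/
lemma setIntegral_rpow_mul_radialDeriv {α : ℝ} (hα : 0 < α) {h : ℝ → ℝ}
    (hh : IntegrableOn h (Ioo 0 (2 * π))) {φ : V2 → ℝ} (hφ : ContDiff ℝ (⊤ : ℕ∞) φ)
    (hc : HasCompactSupport φ) (hs : tsupport φ ⊆ Metric.ball (0 : V2) 1) :
    ∫ p in polarRect, p.1 ^ α * h p.2 * radialDeriv φ p =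
      -α * ∫ p in polarRect, p.1 ^ (α - 1) * h p.2 * φ (polarMap p) := by
  rw [setIntegral_polarRect_swap (integrableOn_polarRect_mul (integrableOn_rpow_Ioo (by linarith))
      hh (continuous_radialDeriv hφ) (exists_bound_radialDeriv hφ hc)),
    setIntegral_polarRect_swap (integrableOn_polarRect_mul (integrableOn_rpow_Ioo (by linarith))
      hh (continuous_comp_polarMap hφ) (exists_bound_comp_polarMap hφ hc)),
    ← MeasureTheory.integral_const_mul]
  congr 1 with θ
  have key := integral_rpow_mul_deriv hα
    (fun r => hasDerivAt_comp_polarMap_fst (hφ.differentiable (by simp)) r θ)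
    ((continuous_radialDeriv hφ).comp (by fun_prop))
    (eq_zero_of_tsupport_subset_ball hs (by rw [norm_polarMap zero_le_one]))
  calc ∫ r in Ioo (0 : ℝ) 1, r ^ α * h θ * radialDeriv φ (r, θ)
      = ∫ r in Ioo (0 : ℝ) 1, h θ * (r ^ α * radialDeriv φ (r, θ)) := by
        congr 1 with r; ring
    _ = -α * (h θ * ∫ r in Ioo (0 : ℝ) 1, r ^ (α - 1) * φ (polarMap (r, θ))) := by
        rw [MeasureTheory.integral_const_mul, key]; ring
    _ = _ := by
        rw [← MeasureTheory.integral_const_mul]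
        congr 2 with r; ring

/-- If `(H₁)' = -H₀` weakly on the circle, then `H₁` may be integrated by parts in the angular
variable over the polar rectangle. -/
lemma setIntegral_rpow_mul_tangentialDeriv {β : ℝ} (hβ : -1 < β) {H₁ H₀ : ℝ → ℝ}
    (hH₁ : IntegrableOn H₁ (Ioo 0 (2 * π))) (hH₀ : IntegrableOn H₀ (Ioo 0 (2 * π)))
    (hweak : ∀ ψ : ℝ → ℝ, ContDiff ℝ (⊤ : ℕ∞) ψ → Function.Periodic ψ (2 * π) →
      ∫ t in Ioo 0 (2 * π), H₁ t * deriv ψ t = ∫ t in Ioo 0 (2 * π), H₀ t * ψ t)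
    {φ : V2 → ℝ} (hφ : ContDiff ℝ (⊤ : ℕ∞) φ) (hc : HasCompactSupport φ) :
    ∫ p in polarRect, p.1 ^ (β + 1) * H₁ p.2 * tangentialDeriv φ p =
      ∫ p in polarRect, p.1 ^ β * H₀ p.2 * φ (polarMap p) := by
  rw [setIntegral_polarRect (integrableOn_polarRect_mul (integrableOn_rpow_Ioo (by linarith))
      hH₁ (continuous_tangentialDeriv hφ) (exists_bound_tangentialDeriv hφ hc)),
    setIntegral_polarRect (integrableOn_polarRect_mul (integrableOn_rpow_Ioo hβ)
      hH₀ (continuous_comp_polarMap hφ) (exists_bound_comp_polarMap hφ hc))]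
  refine setIntegral_congr_fun measurableSet_Ioo fun r hr => ?_
  have hψ : ContDiff ℝ (⊤ : ℕ∞) fun t => φ (polarMap (r, t)) :=
    hφ.comp (contDiff_polarMap.comp (contDiff_const.prodMk contDiff_id))
  have key := hweak _ hψ (fun t => by
    simp only [polarMap, Real.cos_add_two_pi, Real.sin_add_two_pi])
  simp only [(hasDerivAt_comp_polarMap_snd (hφ.differentiable (by simp)) r _).deriv] at key
  calc ∫ θ in Ioo 0 (2 * π), r ^ (β + 1) * H₁ θ * tangentialDeriv φ (r, θ)
      = r ^ β * ∫ θ in Ioo 0 (2 * π), H₁ θ * (r * tangentialDeriv φ (r, θ)) := by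
        rw [← MeasureTheory.integral_const_mul, Real.rpow_add_one hr.1.ne']
        congr 1 with θ; ring
    _ = ∫ θ in Ioo 0 (2 * π), r ^ β * H₀ θ * φ (polarMap (r, θ)) := by
        rw [key, ← MeasureTheory.integral_const_mul]
        congr 1 with θ; ring

/-- The weak derivative on the circle of the product of an absolutely continuous function and a
smooth function. -/
lemma integral_mul_mul_deriv_of_primitive {Θ Θ' σ σ' ψ : ℝ → ℝ}
    (hΘper : Function.Periodic Θ (2 * π))
    (hΘ'loc : LocallyIntegrable Θ') (hac : ∀ s t : ℝ, Θ t = Θ s + ∫ r in s..t, Θ' r)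
    (hσ : ContDiff ℝ (⊤ : ℕ∞) σ) (hσper : Function.Periodic σ (2 * π))
    (hσ' : ∀ t, HasDerivAt σ (σ' t) t)
    (hψ : ContDiff ℝ (⊤ : ℕ∞) ψ) (hψper : Function.Periodic ψ (2 * π)) :
    ∫ t in Ioo 0 (2 * π), Θ t * σ t * deriv ψ t =
      ∫ t in Ioo 0 (2 * π), (-(Θ' t * σ t) - Θ t * σ' t) * ψ t := by
  have h := integral_mul_deriv_of_primitive hΘper hΘ'loc hac (hσ.mul hψ) (hσper.mul hψper)
  have hΘc := continuous_of_primitive hΘ'loc hac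
  have hσ'c : Continuous σ' := by
    rw [show σ' = deriv σ from funext fun t => (hσ' t).deriv.symm]
    exact hσ.continuous_deriv (by simp)
  have hψ'c : Continuous (deriv ψ) := hψ.continuous_deriv (by simp)
  have i1 : IntegrableOn (fun t => Θ t * σ t * deriv ψ t) (Ioo 0 (2 * π)) :=
    integrableOn_Ioo_of_continuous ((hΘc.mul hσ.continuous).mul hψ'c) _ _
  have i2 : IntegrableOn (fun t => Θ t * σ' t * ψ t) (Ioo 0 (2 * π)) :=
    integrableOn_Ioo_of_continuous ((hΘc.mul hσ'c).mul hψ.continuous) _ _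
  have i3 : IntegrableOn (fun t => -(Θ' t * (σ t * ψ t))) (Ioo 0 (2 * π)) :=
    (integrableOn_Ioo_mul_continuous hΘ'loc (hσ.continuous.mul hψ.continuous) _ _).neg
  have e1 (t : ℝ) : Θ t * deriv (fun x => σ x * ψ x) t =
      Θ t * σ t * deriv ψ t + Θ t * σ' t * ψ t := by
    rw [((hσ' t).fun_mul (hψ.differentiable (by simp) t).hasDerivAt).deriv]
    ring
  have e2 (t : ℝ) : (-(Θ' t * σ t) - Θ t * σ' t) * ψ t =
      -(Θ' t * (σ t * ψ t)) - Θ t * σ' t * ψ t := by ring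
  simp only [e1, e2] at h ⊢
  rw [MeasureTheory.integral_add i1 i2] at h
  rw [MeasureTheory.integral_sub i3 i2, MeasureTheory.integral_neg]
  linarith

/-- The partial derivatives of `r ^ γ * Θ θ` in polar coordinates: here `c` and `s` are the
radial and the angular component of a coordinate direction. -/
lemma setIntegral_polar_weakGradient {γ : ℝ} (hγ : 0 < γ) {Θ Θ' c s : ℝ → ℝ}
    (hΘper : Function.Periodic Θ (2 * π))
    (hΘ'loc : LocallyIntegrable Θ') (hac : ∀ s t : ℝ, Θ t = Θ s + ∫ r in s..t, Θ' r)
    (hc : Continuous c) (hs : ContDiff ℝ (⊤ : ℕ∞) s) (hsper : Function.Periodic s (2 * π))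
    (hsc : ∀ t, HasDerivAt s (-c t) t)
    {φ : V2 → ℝ} (hφ : ContDiff ℝ (⊤ : ℕ∞) φ) (hφc : HasCompactSupport φ)
    (hφs : tsupport φ ⊆ Metric.ball (0 : V2) 1) :
    ∫ p in polarRect, p.1 * (p.1 ^ γ * Θ p.2 *
        (c p.2 * radialDeriv φ p + s p.2 * tangentialDeriv φ p)) =
      -∫ p in polarRect, p.1 * (p.1 ^ (γ - 1) * (γ * Θ p.2 * c p.2 + Θ' p.2 * s p.2) *
        φ (polarMap p)) := by
  have hΘc := continuous_of_primitive hΘ'loc hac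
  have iΘc : IntegrableOn (fun t => Θ t * c t) (Ioo 0 (2 * π)) :=
    integrableOn_Ioo_of_continuous (hΘc.mul hc) _ _
  have iΘs : IntegrableOn (fun t => Θ t * s t) (Ioo 0 (2 * π)) :=
    integrableOn_Ioo_of_continuous (hΘc.mul hs.continuous) _ _
  have iH : IntegrableOn (fun t => -(Θ' t * s t) - Θ t * -c t) (Ioo 0 (2 * π)) :=
    (integrableOn_Ioo_mul_continuous hΘ'loc hs.continuous _ _).neg.sub
      (integrableOn_Ioo_of_continuous (hΘc.mul hc.neg) _ _)
  have hR := setIntegral_rpow_mul_radialDeriv (α := γ + 1) (by linarith) iΘc hφ hφc hφs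
  have hT := setIntegral_rpow_mul_tangentialDeriv (β := γ) (by linarith) iΘs iH
    (fun ψ hψ hψper =>
      integral_mul_mul_deriv_of_primitive hΘper hΘ'loc hac hs hsper hsc hψ hψper) hφ hφc
  have iR := integrableOn_polarRect_mul (integrableOn_rpow_Ioo (s := γ + 1) (by linarith)) iΘc
    (continuous_radialDeriv hφ) (exists_bound_radialDeriv hφ hφc)
  have iT := integrableOn_polarRect_mul (integrableOn_rpow_Ioo (s := γ + 1) (by linarith)) iΘs
    (continuous_tangentialDeriv hφ) (exists_bound_tangentialDeriv hφ hφc)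
  have iR' := integrableOn_polarRect_mul (integrableOn_rpow_Ioo (s := γ) (by linarith)) iΘc
    (continuous_comp_polarMap hφ) (exists_bound_comp_polarMap hφ hφc)
  have iT' := integrableOn_polarRect_mul (integrableOn_rpow_Ioo (s := γ) (by linarith)) iH
    (continuous_comp_polarMap hφ) (exists_bound_comp_polarMap hφ hφc)
  rw [add_sub_cancel_right] at hR
  calc ∫ p in polarRect, p.1 * (p.1 ^ γ * Θ p.2 *
        (c p.2 * radialDeriv φ p + s p.2 * tangentialDeriv φ p))
      = ∫ p in polarRect, (p.1 ^ (γ + 1) * (Θ p.2 * c p.2) * radialDeriv φ p +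
          p.1 ^ (γ + 1) * (Θ p.2 * s p.2) * tangentialDeriv φ p) := by
        refine setIntegral_congr_fun measurableSet_polarRect fun p hp => ?_
        simp only [Real.rpow_add_one hp.1.1.ne']
        ring
    _ = ∫ p in polarRect, (-(γ + 1) * (p.1 ^ γ * (Θ p.2 * c p.2) * φ (polarMap p)) +
          p.1 ^ γ * (-(Θ' p.2 * s p.2) - Θ p.2 * -c p.2) * φ (polarMap p)) := by
        rw [MeasureTheory.integral_add iR iT, hR, hT,
          MeasureTheory.integral_add (iR'.const_mul _) iT', MeasureTheory.integral_const_mul]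
    _ = _ := by
        rw [← MeasureTheory.integral_neg]
        refine setIntegral_congr_fun measurableSet_polarRect fun p hp => ?_
        have e : p.1 ^ γ = p.1 ^ (γ - 1) * p.1 := by
          rw [← Real.rpow_add_one hp.1.1.ne', sub_add_cancel]
        simp only [e]
        ring

/-- The divergence-form equation for `r ^ γ * Θ θ` in polar coordinates. -/
lemma setIntegral_polar_divergence {γ : ℝ} (hγ : 0 < γ) {H₁ H₀ : ℝ → ℝ}
    (hH₁ : IntegrableOn H₁ (Ioo 0 (2 * π))) (hH₀ : IntegrableOn H₀ (Ioo 0 (2 * π)))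
    (hweak : ∀ ψ : ℝ → ℝ, ContDiff ℝ (⊤ : ℕ∞) ψ → Function.Periodic ψ (2 * π) →
      ∫ t in Ioo 0 (2 * π), H₁ t * deriv ψ t = γ ^ 2 * ∫ t in Ioo 0 (2 * π), H₀ t * ψ t)
    {φ : V2 → ℝ} (hφ : ContDiff ℝ (⊤ : ℕ∞) φ) (hφc : HasCompactSupport φ)
    (hφs : tsupport φ ⊆ Metric.ball (0 : V2) 1) :
    ∫ p in polarRect, p.1 * (p.1 ^ (γ - 1) *
      (γ * H₀ p.2 * radialDeriv φ p + H₁ p.2 * tangentialDeriv φ p)) = 0 := by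
  have hR := setIntegral_rpow_mul_radialDeriv hγ hH₀ hφ hφc hφs
  have hT := setIntegral_rpow_mul_tangentialDeriv (β := γ - 1) (by linarith) hH₁
    (hH₀.const_mul (γ ^ 2)) (fun ψ hψ hψper => by
      rw [hweak ψ hψ hψper, ← MeasureTheory.integral_const_mul]
      simp only [mul_assoc]) hφ hφc
  have iR := integrableOn_polarRect_mul (integrableOn_rpow_Ioo (s := γ) (by linarith)) hH₀
    (continuous_radialDeriv hφ) (exists_bound_radialDeriv hφ hφc)
  have iT := integrableOn_polarRect_mul (integrableOn_rpow_Ioo (s := γ) (by linarith)) hH₁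
    (continuous_tangentialDeriv hφ) (exists_bound_tangentialDeriv hφ hφc)
  rw [sub_add_cancel] at hT
  calc ∫ p in polarRect, p.1 * (p.1 ^ (γ - 1) *
        (γ * H₀ p.2 * radialDeriv φ p + H₁ p.2 * tangentialDeriv φ p))
      = ∫ p in polarRect, (γ * (p.1 ^ γ * H₀ p.2 * radialDeriv φ p) +
          p.1 ^ γ * H₁ p.2 * tangentialDeriv φ p) := by
        refine setIntegral_congr_fun measurableSet_polarRect fun p hp => ?_
        have e : p.1 ^ γ = p.1 ^ (γ - 1) * p.1 := by
          rw [← Real.rpow_add_one hp.1.1.ne', sub_add_cancel]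
        simp only [e]
        ring
    _ = γ * (-γ * ∫ p in polarRect, p.1 ^ (γ - 1) * H₀ p.2 * φ (polarMap p)) +
          γ ^ 2 * ∫ p in polarRect, p.1 ^ (γ - 1) * H₀ p.2 * φ (polarMap p) := by
        rw [MeasureTheory.integral_add (iR.const_mul _) iT, MeasureTheory.integral_const_mul, hR,
          hT, ← MeasureTheory.integral_const_mul (γ ^ 2)]
        congr 2 with p
        ring
    _ = 0 := by ring

/-- The gradient of `r ^ γ * Θ θ`, written in terms of `Θ` and its derivative `Θ'`. -/
def polarGradient (γ : ℝ) (Θ Θ' : ℝ → ℝ) (x : V2) : Fin 2 → ℝ :=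
  ![‖x‖ ^ (γ - 1) * (γ * Θ (arg2 x) * Real.cos (arg2 x) + Θ' (arg2 x) * -Real.sin (arg2 x)),
    ‖x‖ ^ (γ - 1) * (γ * Θ (arg2 x) * Real.sin (arg2 x) + Θ' (arg2 x) * Real.cos (arg2 x))]

lemma arg2_polarMap_of_mem {p : ℝ × ℝ} (hp : p ∈ polarRect) : arg2 (polarMap p) = p.2 :=
  arg2_polarMap hp.1.1 hp.2.1 hp.2.2

lemma gradf_zero_polarMap (φ : V2 → ℝ) (p : ℝ × ℝ) : gradf φ (polarMap p) 0 =
    Real.cos p.2 * radialDeriv φ p + -Real.sin p.2 * tangentialDeriv φ p := by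
  unfold radialDeriv tangentialDeriv
  linear_combination -gradf φ (polarMap p) 0 * Real.sin_sq_add_cos_sq p.2

lemma gradf_one_polarMap (φ : V2 → ℝ) (p : ℝ × ℝ) : gradf φ (polarMap p) 1 =
    Real.sin p.2 * radialDeriv φ p + Real.cos p.2 * tangentialDeriv φ p := by
  unfold radialDeriv tangentialDeriv
  linear_combination -gradf φ (polarMap p) 1 * Real.sin_sq_add_cos_sq p.2

lemma dot2_Amat_polarGradient (k1 k2 : ℝ → ℝ) (γ : ℝ) (Θ Θ' : ℝ → ℝ) (φ : V2 → ℝ) {p : ℝ × ℝ}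
    (hp : p ∈ polarRect) :
    dot2 ((Amat k1 k2 (polarMap p)).mulVec (polarGradient γ Θ Θ' (polarMap p)))
      (gradf φ (polarMap p)) = p.1 ^ (γ - 1) *
        (γ * (k1 p.2 * Θ p.2) * radialDeriv φ p + k2 p.2 * Θ' p.2 * tangentialDeriv φ p) := by
  simp only [dot2, gradf_zero_polarMap, gradf_one_polarMap, Amat, Jmat, polarGradient,
    arg2_polarMap_of_mem hp, norm_polarMap hp.1.1.le, Matrix.mulVec, dotProduct,
    Matrix.mul_apply, Fin.sum_univ_two, Matrix.diagonal_apply, Matrix.transpose_apply,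
    Matrix.of_apply, Matrix.cons_val', Matrix.cons_val_zero, Matrix.cons_val_one]
  simp
  have hc : Real.cos p.2 ^ 2 = 1 - Real.sin p.2 ^ 2 := Real.cos_sq' p.2
  generalize Real.cos p.2 = c at *
  generalize Real.sin p.2 = s at *
  generalize p.1 ^ (γ - 1) = ρ at *
  have hc4 : c ^ 4 = (1 - s ^ 2) ^ 2 := by rw [← hc]; ring
  ring_nf
  simp only [hc, hc4]
  ring

/-- If `Θ` is a `2π`-periodic locally absolutely continuous weak solution of
`−(k₂Θ')' = γ²k₁Θ`, then `u(x) = |x|^γ Θ(arg x)` belongs to `H¹(B₁(0))` and is a weak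
solution of `div(A∇u) = 0` in the unit disk, where
`A = J(arg x) diag(k₁, k₂)(arg x) J(arg x)ᵀ`. -/
theorem stmt5 (k1 k2 : ℝ → ℝ)
    (hk1m : Measurable k1) (hk2m : Measurable k2)
    (hk1p : ∀ t, 0 < k1 t) (hk2p : ∀ t, 0 < k2 t)
    (hk1inf : ∃ c > (0 : ℝ), ∀ᵐ t : ℝ, c ≤ k1 t) (hk2inf : ∃ c > (0 : ℝ), ∀ᵐ t : ℝ, c ≤ k2 t)
    (hk1b : ∃ C : ℝ, ∀ t, k1 t ≤ C) (hk2b : ∃ C : ℝ, ∀ t, k2 t ≤ C)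
    (hk1per : Function.Periodic k1 (2 * π)) (hk2per : Function.Periodic k2 (2 * π))
    (γ : ℝ) (hγ : 0 < γ)
    (Θ Θ' : ℝ → ℝ) (hΘper : Function.Periodic Θ (2 * π))
    (hΘ'loc : LocallyIntegrable Θ')
    (hac : ∀ s t : ℝ, Θ t = Θ s + ∫ r in s..t, Θ' r)
    (hΘ'L2 : IntegrableOn (fun t => (Θ' t) ^ 2) (Ioc 0 (2 * π)))
    (hode : ∀ ψ : ℝ → ℝ, ContDiff ℝ (⊤ : ℕ∞) ψ → Function.Periodic ψ (2 * π) →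
      (∫ t in (0 : ℝ)..(2 * π), k2 t * Θ' t * deriv ψ t) =
        γ ^ 2 * ∫ t in (0 : ℝ)..(2 * π), k1 t * Θ t * ψ t) :
    ∃ g : V2 → Fin 2 → ℝ,
      IntegrableOn
        (fun x : V2 => ((fun y : V2 => if y = 0 then 0 else ‖y‖ ^ γ * Θ (arg2 y)) x) ^ 2)
        (Metric.ball (0 : V2) 1) ∧
      IntegrableOn (fun x => dot2 (g x) (g x)) (Metric.ball (0 : V2) 1) ∧
      IsWeakGradient (Metric.ball (0 : V2) 1)
        (fun y : V2 => if y = 0 then 0 else ‖y‖ ^ γ * Θ (arg2 y)) g ∧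
      ∀ φ : V2 → ℝ, ContDiff ℝ (⊤ : ℕ∞) φ → HasCompactSupport φ →
        tsupport φ ⊆ Metric.ball (0 : V2) 1 →
        (∫ x in Metric.ball (0 : V2) 1,
          dot2 ((Amat k1 k2 x).mulVec (g x)) (gradf φ x)) = 0 := by
  have hΘc := continuous_of_primitive hΘ'loc hac
  have hpi : (0 : ℝ) ≤ 2 * π := by positivity
  have hbdd {k : ℝ → ℝ} (hm : Measurable k) (hp : ∀ t, 0 < k t) (hb : ∃ C : ℝ, ∀ t, k t ≤ C)
      {v : ℝ → ℝ} (hv : IntegrableOn v (Ioo 0 (2 * π))) :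
      IntegrableOn (fun t => k t * v t) (Ioo 0 (2 * π)) := by
    obtain ⟨C, hC⟩ := hb
    refine Integrable.bdd_mul (c := C) hv hm.aestronglyMeasurable
      (Filter.Eventually.of_forall fun t => ?_)
    rw [Real.norm_of_nonneg (hp t).le]
    exact hC t
  refine ⟨polarGradient γ Θ Θ', ?_, ?_, ?_, ?_⟩
  · rw [integrableOn_ball_iff_polar]
    have h := integrableOn_polarRect_mul
      (integrableOn_rpow_Ioo (s := 2 * γ + 1) (by linarith))
      (integrableOn_Ioo_of_continuous (hΘc.pow 2) 0 (2 * π)) (continuous_const (y := (1 : ℝ)))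
      ⟨1, fun _ => by simp⟩
    refine h.congr_fun (fun p hp => ?_) measurableSet_polarRect
    simp only [if_neg (polarMap_ne_zero hp.1.1), norm_polarMap hp.1.1.le,
      arg2_polarMap_of_mem hp, Real.rpow_add_one hp.1.1.ne', Pi.pow_apply]
    rw [two_mul, Real.rpow_add hp.1.1]
    ring
  · rw [integrableOn_ball_iff_polar]
    have h := integrableOn_polarRect_mul
      (integrableOn_rpow_Ioo (s := γ - 1 + (γ - 1) + 1) (by linarith))
      ((integrableOn_Ioo_of_continuous ((hΘc.pow 2).const_mul (γ ^ 2)) 0 (2 * π)).add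
        (hΘ'L2.mono_set Ioo_subset_Ioc_self)) (continuous_const (y := (1 : ℝ)))
      ⟨1, fun _ => by simp⟩
    refine h.congr_fun (fun p hp => ?_) measurableSet_polarRect
    simp only [dot2, polarGradient, norm_polarMap hp.1.1.le, arg2_polarMap_of_mem hp,
      Real.rpow_add_one hp.1.1.ne', Real.rpow_add hp.1.1, Matrix.cons_val_zero,
      Matrix.cons_val_one, Pi.add_apply, Pi.pow_apply]
    linear_combination (-p.1 * (p.1 ^ (γ - 1)) ^ 2 * (γ ^ 2 * Θ p.2 ^ 2 + Θ' p.2 ^ 2)) *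
      Real.sin_sq_add_cos_sq p.2
  · intro φ hφ hφc hφs i
    rw [setIntegral_ball_eq_polar, setIntegral_ball_eq_polar]
    fin_cases i
    · have h := setIntegral_polar_weakGradient hγ hΘper hΘ'loc hac Real.continuous_cos
        Real.contDiff_sin.neg (fun t => by simp only [Real.sin_add_two_pi])
        (fun t => (Real.hasDerivAt_sin t).fun_neg) hφ hφc hφs
      convert h using 1
      · refine setIntegral_congr_fun measurableSet_polarRect fun p hp => ?_
        simp only [if_neg (polarMap_ne_zero hp.1.1), norm_polarMap hp.1.1.le,
          arg2_polarMap_of_mem hp, Fin.zero_eta, gradf_zero_polarMap]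
      · congr 1
        refine setIntegral_congr_fun measurableSet_polarRect fun p hp => ?_
        simp only [polarGradient, norm_polarMap hp.1.1.le, arg2_polarMap_of_mem hp,
          Fin.zero_eta, Matrix.cons_val_zero]
    · have h := setIntegral_polar_weakGradient hγ hΘper hΘ'loc hac Real.continuous_sin
        Real.contDiff_cos Real.cos_periodic Real.hasDerivAt_cos hφ hφc hφs
      convert h using 1
      · refine setIntegral_congr_fun measurableSet_polarRect fun p hp => ?_
        simp only [if_neg (polarMap_ne_zero hp.1.1), norm_polarMap hp.1.1.le,
          arg2_polarMap_of_mem hp, Fin.mk_one, gradf_one_polarMap]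
      · congr 1
        refine setIntegral_congr_fun measurableSet_polarRect fun p hp => ?_
        simp only [polarGradient, norm_polarMap hp.1.1.le, arg2_polarMap_of_mem hp,
          Fin.mk_one, Matrix.cons_val_one, Matrix.cons_val_fin_one]
  · intro φ hφ hφc hφs
    rw [setIntegral_ball_eq_polar]
    have hΘ'i : IntegrableOn Θ' (Ioo 0 (2 * π)) :=
      (hΘ'loc.integrableOn_isCompact isCompact_Icc).mono_set Ioo_subset_Icc_self
    have h := setIntegral_polar_divergence hγ (hbdd hk2m hk2p hk2b hΘ'i)
      (hbdd hk1m hk1p hk1b (integrableOn_Ioo_of_continuous hΘc _ _))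
      (fun ψ hψ hψper => by
        have := hode ψ hψ hψper
        rwa [intervalIntegral.integral_of_le hpi, intervalIntegral.integral_of_le hpi,
          integral_Ioc_eq_integral_Ioo, integral_Ioc_eq_integral_Ioo] at this) hφ hφc hφs
    rw [← h]
    refine setIntegral_congr_fun measurableSet_polarRect fun p hp => ?_
    simp only [dot2_Amat_polarGradient k1 k2 γ Θ Θ' φ hp]
end
end

section
/- Let 0 ≤ θ₁ < θ₂ ≤ θ₁ + π and let 𝒞 = { y ∈ ℝ² \ {0} : arg y ∈ [θ₁, θ₂) ∪ [θ₁ + π, θ₂ + π) (mod 2π) } be the corresponding two-sided cone with vertex at the origin. Then for every x ∈ ℝ² with |x| < 1, the Lebesgue measure of { t ∈ [0, 2π) : x + e^{it} ∈ 𝒞 } equals the Lebesgue measure of { t ∈ [0, 2π) : e^{it} ∈ 𝒞 }, namely 2(θ₂ − θ₁). Equivalently, the arclength of 𝒞 ∩ S₁(x) equals the arclength of 𝒞 ∩ S₁(0). -/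
open MeasureTheory Real Set

noncomputable section

def eit (t : ℝ) : V2 := toV ![Real.cos t, Real.sin t]

/-- Membership in the two-sided cone with vertex `0` and aperture
`[θ₁, θ₂) ∪ [θ₁ + π, θ₂ + π)` (mod `2π`). -/
def inCone (θ₁ θ₂ : ℝ) (y : V2) : Prop :=
  y ≠ 0 ∧ ∃ k : ℤ, arg2 y - 2 * π * k ∈ Ico θ₁ θ₂ ∪ Ico (θ₁ + π) (θ₂ + π)

@[simp] lemma eit_apply_zero (t : ℝ) : eit t 0 = Real.cos t := rfl

@[simp] lemma eit_apply_one (t : ℝ) : eit t 1 = Real.sin t := rfl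

lemma exists_arg2_smul_eit {s : ℝ} (hs : 0 < s) (φ : ℝ) :
    ∃ m : ℤ, arg2 (s • eit φ) = φ + 2 * π * m := by
  have h : Complex.mk ((s • eit φ) 0) ((s • eit φ) 1) =
      (s : ℂ) * (Complex.cos φ + Complex.sin φ * Complex.I) := by
    apply Complex.ext <;> simp [← Complex.ofReal_cos, ← Complex.ofReal_sin]
  have harg := Complex.arg_mul_cos_add_sin_mul_I_eq_toIocMod hs φ
  rw [← h, toIocMod, zsmul_eq_mul] at harg
  unfold arg2
  split_ifs
  · refine ⟨-toIocDiv Real.two_pi_pos (-π) φ, ?_⟩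
    rw [harg]; push_cast; ring
  · refine ⟨1 - toIocDiv Real.two_pi_pos (-π) φ, ?_⟩
    rw [harg]; push_cast; ring

lemma eit_ne_zero (t : ℝ) : eit t ≠ 0 := by
  intro h
  have h0 : Real.cos t = 0 := by simpa using congrArg (fun v : V2 => v 0) h
  have h1 : Real.sin t = 0 := by simpa using congrArg (fun v : V2 => v 1) h
  have := Real.sin_sq_add_cos_sq t
  simp [h0, h1] at this

lemma inCone_smul_eit_iff {θ₁ θ₂ s : ℝ} (hs : 0 < s) (φ : ℝ) :
    inCone θ₁ θ₂ (s • eit φ) ↔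
      ∃ k : ℤ, φ - 2 * π * k ∈ Ico θ₁ θ₂ ∪ Ico (θ₁ + π) (θ₂ + π) := by
  obtain ⟨m, hm⟩ := exists_arg2_smul_eit hs φ
  rw [inCone, hm, and_iff_right (smul_ne_zero hs.ne' (eit_ne_zero φ))]
  constructor
  · rintro ⟨k, hk⟩
    refine ⟨k - m, ?_⟩
    convert hk using 1
    push_cast; ring
  · rintro ⟨k, hk⟩
    refine ⟨k + m, ?_⟩
    convert hk using 1
    push_cast; ring

/-- The parameter `t` for which `x + e^{it}` lies on the ray from the origin in direction `φ`. -/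
def rayParam (x : V2) (φ : ℝ) : ℝ :=
  φ + Real.arcsin (x 0 * Real.sin φ - x 1 * Real.cos φ)

lemma rayParam_add_pi (x : V2) (φ : ℝ) :
    rayParam x (φ + π) = φ + π - Real.arcsin (x 0 * Real.sin φ - x 1 * Real.cos φ) := by
  rw [rayParam, Real.sin_add_pi, Real.cos_add_pi, sub_eq_add_neg (φ + π), ← Real.arcsin_neg]
  congr 2
  ring

lemma rayParam_add_int_mul_two_pi (x : V2) (φ : ℝ) (k : ℤ) :
    rayParam x (φ + k * (2 * π)) = rayParam x φ + k * (2 * π) := by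
  simp only [rayParam, Real.sin_add_int_mul_two_pi, Real.cos_add_int_mul_two_pi]
  ring

lemma rayParam_add_two_pi (x : V2) (φ : ℝ) :
    rayParam x (φ + 2 * π) = rayParam x φ + 2 * π := by
  simpa using rayParam_add_int_mul_two_pi x φ 1

lemma continuous_rayParam (x : V2) : Continuous (rayParam x) := by
  unfold rayParam
  exact continuous_id.add (Real.continuous_arcsin.comp (by fun_prop))

lemma exists_add_eit_rayParam {x : V2} (hx : ‖x‖ < 1) (φ : ℝ) :
    ∃ s : ℝ, 0 < s ∧ x + eit (rayParam x φ) = s • eit φ := by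
  have hx2 : x 0 ^ 2 + x 1 ^ 2 < 1 := by
    have h := EuclideanSpace.norm_sq_eq x
    simp only [Fin.sum_univ_two, Real.norm_eq_abs, sq_abs] at h
    rw [← h]
    nlinarith [norm_nonneg x]
  have htrig := Real.sin_sq_add_cos_sq φ
  set c := x 0 * Real.sin φ - x 1 * Real.cos φ with hc
  set d := x 0 * Real.cos φ + x 1 * Real.sin φ with hd
  have hcd : c ^ 2 + d ^ 2 = x 0 ^ 2 + x 1 ^ 2 := by
    rw [hc, hd]; linear_combination (x 0 ^ 2 + x 1 ^ 2) * htrig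
  have hs : |d| < √(1 - c ^ 2) := by
    apply Real.lt_sqrt_of_sq_lt
    rw [sq_abs]; linarith
  have hc1 : |c| ≤ 1 := by
    rw [← sq_le_one_iff_abs_le_one]; nlinarith [sq_nonneg d]
  have hsin : Real.sin (Real.arcsin c) = c :=
    Real.sin_arcsin (abs_le.mp hc1).1 (abs_le.mp hc1).2
  refine ⟨d + √(1 - c ^ 2), by linarith [neg_abs_le d], ?_⟩
  ext i
  fin_cases i
  · simp only [rayParam, Fin.zero_eta, PiLp.add_apply, PiLp.smul_apply, eit_apply_zero,
      smul_eq_mul, Real.cos_add, ← hc, hsin, Real.cos_arcsin]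
    rw [hc, hd]
    linear_combination -x 0 * htrig
  · simp only [rayParam, Fin.mk_one, PiLp.add_apply, PiLp.smul_apply, eit_apply_one,
      smul_eq_mul, Real.sin_add, ← hc, hsin, Real.cos_arcsin]
    rw [hc, hd]
    linear_combination -x 1 * htrig

lemma rayParam_injective {x : V2} (hx : ‖x‖ < 1) : Function.Injective (rayParam x) := by
  intro φ ψ h
  obtain ⟨s, hs, hs'⟩ := exists_add_eit_rayParam hx φ
  obtain ⟨r, hr, hr'⟩ := exists_add_eit_rayParam hx ψ
  obtain ⟨m, hm⟩ := exists_arg2_smul_eit hs φ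
  obtain ⟨n, hn⟩ := exists_arg2_smul_eit hr ψ
  rw [← hs', h, hr', hn] at hm
  have hψ : φ = ψ + ((n - m : ℤ) : ℝ) * (2 * π) := by push_cast; linarith
  rw [hψ, rayParam_add_int_mul_two_pi] at h
  linarith

lemma rayParam_strictMono {x : V2} (hx : ‖x‖ < 1) : StrictMono (rayParam x) := by
  refine ((continuous_rayParam x).strictMono_of_inj (rayParam_injective hx)).resolve_right ?_
  intro hanti
  have h := hanti Real.two_pi_pos
  have h' := rayParam_add_two_pi x 0
  rw [zero_add] at h'
  linarith [Real.two_pi_pos]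

lemma rayParam_surjective (x : V2) : Function.Surjective (rayParam x) := by
  intro t
  refine mem_range_of_exists_le_of_exists_ge (continuous_rayParam x) ⟨t - π / 2, ?_⟩
    ⟨t + π / 2, ?_⟩
  · rw [rayParam]
    linarith [Real.arcsin_le_pi_div_two (x 0 * Real.sin (t - π / 2) - x 1 * Real.cos (t - π / 2))]
  · rw [rayParam]
    linarith [Real.neg_pi_div_two_le_arcsin
      (x 0 * Real.sin (t + π / 2) - x 1 * Real.cos (t + π / 2))]

lemma inCone_add_eit_rayParam_iff {x : V2} (hx : ‖x‖ < 1) {θ₁ θ₂ : ℝ} (φ : ℝ) :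
    inCone θ₁ θ₂ (x + eit (rayParam x φ)) ↔
      ∃ k : ℤ, φ - 2 * π * k ∈ Ico θ₁ θ₂ ∪ Ico (θ₁ + π) (θ₂ + π) := by
  obtain ⟨s, hs, h⟩ := exists_add_eit_rayParam hx φ
  rw [h, inCone_smul_eit_iff hs]

lemma continuous_eit : Continuous eit := by
  refine (PiLp.continuous_toLp 2 _).comp (continuous_pi fun i => ?_)
  fin_cases i
  · exact Real.continuous_cos
  · exact Real.continuous_sin

lemma measurable_arg2 : Measurable arg2 := by
  have h : Measurable fun x : V2 => Complex.arg (Complex.mk (x 0) (x 1)) := by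
    refine Complex.measurable_arg.comp ?_
    have : Continuous fun x : V2 => ((x 0 : ℝ) : ℂ) + ((x 1 : ℝ) : ℂ) * Complex.I := by fun_prop
    simpa only [Complex.mk_eq_add_mul_I] using this.measurable
  exact Measurable.ite (measurableSet_le measurable_const h) h (h.add_const _)

lemma measurableSet_inCone (θ₁ θ₂ : ℝ) : MeasurableSet {y | inCone θ₁ θ₂ y} := by
  have h : MeasurableSet (⋃ k : ℤ, (fun y => arg2 y - 2 * π * k) ⁻¹'
      (Ico θ₁ θ₂ ∪ Ico (θ₁ + π) (θ₂ + π))) :=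
    .iUnion fun k => (measurable_arg2.sub_const _) (measurableSet_Ico.union measurableSet_Ico)
  convert (measurableSet_singleton (0 : V2)).compl.inter h using 1
  ext y
  simp [inCone]

/-- A measurable periodic set has the same measure in every half-open period. -/
lemma volume_inter_Ico_eq_of_periodic {S : Set ℝ} (hS : MeasurableSet S) {T : ℝ} (hT : 0 < T)
    (hper : ∀ (k : ℤ) (t : ℝ), k * T + t ∈ S ↔ t ∈ S) (a b : ℝ) :
    volume (S ∩ Ico a (a + T)) = volume (S ∩ Ico b (b + T)) := by
  have hI (c : ℝ) : volume (S ∩ Ico c (c + T)) = volume (S ∩ Ioc c (c + T)) :=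
    measure_congr ((ae_eq_refl S).inter Ico_ae_eq_Ioc)
  rw [hI, hI]
  refine (isAddFundamentalDomain_Ioc hT a).measure_set_eq (isAddFundamentalDomain_Ioc hT b) hS ?_
  rintro ⟨_, k, rfl⟩
  ext t
  simpa [AddSubgroup.vadd_def] using hper k t

lemma inCone_inter_Ico_rayParam {x : V2} (hx : ‖x‖ < 1) {θ₁ θ₂ : ℝ} (h2 : θ₁ < θ₂)
    (h3 : θ₂ ≤ θ₁ + π) :
    {t | inCone θ₁ θ₂ (x + eit t)} ∩ Ico (rayParam x θ₁) (rayParam x θ₁ + 2 * π) =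
      Ico (rayParam x θ₁) (rayParam x θ₂) ∪
        Ico (rayParam x (θ₁ + π)) (rayParam x (θ₂ + π)) := by
  have hmono := rayParam_strictMono hx
  ext t
  obtain ⟨φ, rfl⟩ := rayParam_surjective x t
  rw [← rayParam_add_two_pi]
  simp only [mem_inter_iff, mem_ofPred_eq, inCone_add_eit_rayParam_iff hx, mem_union, mem_Ico,
    hmono.le_iff_le, hmono.lt_iff_lt]
  have hπ := Real.pi_pos
  constructor
  · rintro ⟨⟨k, hk⟩, hφ⟩
    have hk1 : (-1 : ℝ) < k := by
      by_contra! h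
      rcases hk with hk | hk <;> nlinarith
    have hk2 : (k : ℝ) < 1 := by
      by_contra! h
      rcases hk with hk | hk <;> nlinarith
    have hk0 : k = 0 := by
      have h1 : -1 < k := by exact_mod_cast hk1
      have h2 : k < 1 := by exact_mod_cast hk2
      omega
    simpa [hk0] using hk
  · intro h
    refine ⟨⟨0, by simpa using h⟩, ?_⟩
    rcases h with h | h <;> constructor <;> linarith

lemma volume_inCone_add_eit {θ₁ θ₂ : ℝ} (h2 : θ₁ < θ₂) (h3 : θ₂ ≤ θ₁ + π) {x : V2}
    (hx : ‖x‖ < 1) :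
    volume {t ∈ Ico (0 : ℝ) (2 * π) | inCone θ₁ θ₂ (x + eit t)} =
      ENNReal.ofReal (2 * (θ₂ - θ₁)) := by
  have hmono := rayParam_strictMono hx
  have hS : MeasurableSet {t | inCone θ₁ θ₂ (x + eit t)} :=
    (continuous_const.add continuous_eit).measurable (measurableSet_inCone θ₁ θ₂)
  have hper (k : ℤ) (t : ℝ) : k * (2 * π) + t ∈ {t | inCone θ₁ θ₂ (x + eit t)} ↔
      t ∈ {t | inCone θ₁ θ₂ (x + eit t)} := by
    have : eit (k * (2 * π) + t) = eit t := by
      rw [add_comm, eit, Real.cos_add_int_mul_two_pi, Real.sin_add_int_mul_two_pi, eit]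
    simp only [mem_ofPred_eq, this]
  have hvol := volume_inter_Ico_eq_of_periodic hS Real.two_pi_pos hper 0 (rayParam x θ₁)
  rw [inCone_inter_Ico_rayParam hx h2 h3, zero_add, inter_comm] at hvol
  refine hvol.trans ?_
  rw [measure_union _ measurableSet_Ico, Real.volume_Ico, Real.volume_Ico,
    ← ENNReal.ofReal_add (sub_nonneg.2 (hmono h2).le)
      (sub_nonneg.2 (hmono (by linarith : θ₁ + π < θ₂ + π)).le),
    rayParam_add_pi, rayParam_add_pi, rayParam, rayParam]
  · congr 1; ring
  · rw [Set.disjoint_left]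
    intro t ht ht'
    exact absurd (ht.2.trans_le (hmono.monotone h3)) (not_lt.2 ht'.1)

/-- For any two-sided cone `𝒞` with vertex at the origin and any `x` with
`|x| < 1`, the set of parameters `t ∈ [0, 2π)` with `x + e^{it} ∈ 𝒞` has the same Lebesgue
measure as for `x = 0`, namely `2(θ₂ − θ₁)`: the arclength of `𝒞 ∩ S₁(x)` equals that of
`𝒞 ∩ S₁(0)`. -/
theorem stmt7 (θ₁ θ₂ : ℝ) (h1 : 0 ≤ θ₁) (h2 : θ₁ < θ₂) (h3 : θ₂ ≤ θ₁ + π)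
    (x : V2) (hx : ‖x‖ < 1) :
    volume {t ∈ Ico (0 : ℝ) (2 * π) | inCone θ₁ θ₂ (x + eit t)} =
        volume {t ∈ Ico (0 : ℝ) (2 * π) | inCone θ₁ θ₂ (eit t)} ∧
      volume {t ∈ Ico (0 : ℝ) (2 * π) | inCone θ₁ θ₂ (eit t)} =
        ENNReal.ofReal (2 * (θ₂ - θ₁)) := by
  have h0 := volume_inCone_add_eit h2 h3 (x := 0) (by simp)
  simp only [zero_add] at h0
  exact ⟨(volume_inCone_add_eit h2 h3 hx).trans h0.symm, h0⟩
end
end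

section
/- Fix M > 1 and τ ∈ [0,1]; let c = 2/(1 + M^{−τ}), let J(t) be the rotation matrix with rows (cos t, −sin t) and (sin t, cos t), define for x ≠ 0: K_τ(x) = Id if arg x ∈ [0, cπ/2) ∪ [π, π + cπ/2) and K_τ(x) = diag(M, M^{1−2τ}) otherwise, and set A_τ(x) = J(arg x) K_τ(x) J(arg x)^T. Define f(x, ρ) = (1/(2π)) ∫₀^{2π} ⟨e^{it}, A_τ(x + ρe^{it}) e^{it}⟩ / √(det A_τ(x + ρe^{it})) dt. Then there exists m₀ > 1, independent of τ and M, such that f(x, ρ) ≤ f(0, 1) = 2/(1 + M^{−τ}) for all x ∈ ℝ² and all ρ > 0, provided M ∈ (1, m₀^{1/τ}) if τ > 0, and with no restriction on M > 1 if τ = 0. -/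
open MeasureTheory Real Set Matrix intervalIntegral
open scoped Classical

noncomputable section

def quad (A : Matrix (Fin 2) (Fin 2) ℝ) (ξ : Fin 2 → ℝ) : ℝ := dot2 ξ (A.mulVec ξ)

/-- `c = 2/(1 + M^{−τ})`. -/
def cM (M τ : ℝ) : ℝ := 2 / (1 + M ^ (-τ))

/-- The piecewise-constant matrix `K_τ`: the identity on the cone
`arg x ∈ [0, cπ/2) ∪ [π, π + cπ/2)` and `diag(M, M^{1−2τ})` otherwise. -/
def Ktau (M τ : ℝ) (x : V2) : Matrix (Fin 2) (Fin 2) ℝ :=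
  if arg2 x ∈ Ico 0 (cM M τ * π / 2) ∪ Ico π (π + cM M τ * π / 2) then 1
  else Matrix.diagonal ![M, M ^ (1 - 2 * τ)]

/-- The coefficient matrix `A_τ(x) = J(arg x) K_τ(x) J(arg x)ᵀ`. -/
def Atau (M τ : ℝ) (x : V2) : Matrix (Fin 2) (Fin 2) ℝ :=
  Jmat (arg2 x) * Ktau M τ x * (Jmat (arg2 x))ᵀ

/-- `f(x, ρ) = (1/2π) ∫₀^{2π} ⟨e^{it}, A_τ(x + ρe^{it}) e^{it}⟩ / √(det A_τ(x + ρe^{it})) dt`. -/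
def ftau (M τ : ℝ) (x : V2) (ρ : ℝ) : ℝ :=
  (1 / (2 * π)) * ∫ t in (0 : ℝ)..(2 * π),
    quad (Atau M τ (x + ρ • eit t)) (eit t) / Real.sqrt ((Atau M τ (x + ρ • eit t)).det)

lemma arg2_polar (y : V2) :
    ∃ s : ℝ, 0 ≤ s ∧ y 0 = s * Real.cos (arg2 y) ∧ y 1 = s * Real.sin (arg2 y) ∧
      arg2 y ∈ Ico 0 (2 * π) ∧ (s = 0 → arg2 y = 0) := by
  set z : ℂ := ⟨y 0, y 1⟩ with hz
  have hre : y 0 = ‖z‖ * Real.cos z.arg := (Complex.norm_mul_cos_arg z).symm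
  have him : y 1 = ‖z‖ * Real.sin z.arg := (Complex.norm_mul_sin_arg z).symm
  have hdef : arg2 y = if 0 ≤ z.arg then z.arg else z.arg + 2 * π := rfl
  have hl := Complex.neg_pi_lt_arg z
  have hu := Complex.arg_le_pi z
  have hpi := Real.pi_pos
  refine ⟨‖z‖, norm_nonneg z, ?_⟩
  by_cases h : 0 ≤ z.arg
  · rw [if_pos h] at hdef
    rw [hdef]
    refine ⟨hre, him, ⟨h, by linarith⟩, fun h0 => ?_⟩
    rw [norm_eq_zero.mp h0, Complex.arg_zero]
  · rw [if_neg h] at hdef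
    push Not at h
    rw [hdef, Real.cos_add_two_pi, Real.sin_add_two_pi]
    refine ⟨hre, him, ⟨by linarith, by linarith⟩, fun h0 => ?_⟩
    rw [norm_eq_zero.mp h0, Complex.arg_zero] at h
    exact absurd h (lt_irrefl 0)

lemma eq_of_sin_cos_eq {φ ψ : ℝ} (hφ : φ ∈ Ico 0 (2 * π)) (hψ : ψ ∈ Ico 0 (2 * π))
    (hc : Real.cos φ = Real.cos ψ) (hs : Real.sin φ = Real.sin ψ) : φ = ψ := by
  have h : Real.cos (φ - ψ) = 1 := by
    rw [Real.cos_sub, hc, hs]; nlinarith [Real.sin_sq_add_cos_sq ψ]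
  have := (Real.cos_eq_one_iff_of_lt_of_lt (by linarith [hφ.1, hψ.2]) (by linarith [hφ.2, hψ.1])).mp h
  linarith

lemma arg2_eit {t : ℝ} (ht : t ∈ Ico 0 (2 * π)) : arg2 (eit t) = t := by
  obtain ⟨s, hs, h0, h1, hmem, -⟩ := arg2_polar (eit t)
  have e0 : eit t 0 = Real.cos t := rfl
  have e1 : eit t 1 = Real.sin t := rfl
  rw [e0] at h0
  rw [e1] at h1
  have hs1 : s = 1 := by
    have h := Real.sin_sq_add_cos_sq t
    rw [h0, h1] at h
    have h2 : s ^ 2 = 1 := by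
      linear_combination h - s ^ 2 * Real.sin_sq_add_cos_sq (arg2 (eit t))
    nlinarith
  rw [hs1, one_mul] at h0 h1
  exact eq_of_sin_cos_eq hmem ht h0.symm h1.symm

/-- The normalized energy density in the normal direction `e^{it}` at a point of angular
coordinate `φ`, when the radial stretching is `μ` outside of a double cone of opening `a`. -/
def normalEnergy (μ a φ t : ℝ) : ℝ :=
  if φ ∈ Ico 0 a ∪ Ico π (π + a) then 1
  else μ * Real.cos (t - φ) ^ 2 + μ⁻¹ * Real.sin (t - φ) ^ 2

lemma normalEnergy_nonneg {μ : ℝ} (hμ : 0 < μ) (a φ t : ℝ) : 0 ≤ normalEnergy μ a φ t := by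
  unfold normalEnergy
  split_ifs <;> positivity

lemma quad_Atau_div_sqrt_det {M : ℝ} (hM : 0 < M) (τ : ℝ) (y : V2) (t : ℝ) :
    quad (Atau M τ y) (eit t) / Real.sqrt (Atau M τ y).det =
      normalEnergy (M ^ τ) (cM M τ * π / 2) (arg2 y) t := by
  have e0 : eit t 0 = Real.cos t := rfl
  have e1 : eit t 1 = Real.sin t := rfl
  have hJ := Real.sin_sq_add_cos_sq (arg2 y)
  have hdet : (Atau M τ y).det = (Ktau M τ y).det := by
    have hJd : (Jmat (arg2 y)).det = 1 := by
      rw [Jmat, Matrix.det_fin_two_of]; linarith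
    rw [Atau, Matrix.det_mul, Matrix.det_mul, Matrix.det_transpose, hJd]; ring
  have hJt : (Jmat (arg2 y))ᵀ *ᵥ (eit t).ofLp = ![Real.cos (t - arg2 y), Real.sin (t - arg2 y)] := by
    ext i
    fin_cases i
    · simp [Jmat, Matrix.mulVec, dotProduct, Fin.sum_univ_two, e0, e1, Real.cos_sub]; ring
    · simp [Jmat, Matrix.mulVec, dotProduct, Fin.sum_univ_two, e0, e1, Real.sin_sub]; ring
  have hquad : quad (Atau M τ y) (eit t) =
      quad (Ktau M τ y) ![Real.cos (t - arg2 y), Real.sin (t - arg2 y)] := by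
    rw [← hJt]
    simp only [quad, Atau, dot2, Jmat, Matrix.mulVec, dotProduct, Fin.sum_univ_two, Matrix.mul_apply,
      Matrix.transpose_apply, Matrix.of_apply, Matrix.cons_val', Matrix.cons_val_zero,
      Matrix.cons_val_one, Matrix.cons_val_fin_one]
    ring
  rw [hdet, hquad, normalEnergy, Ktau]
  split_ifs with h
  · simp only [quad, dot2, Matrix.one_mulVec, Matrix.det_one, Real.sqrt_one, Matrix.cons_val_zero,
      Matrix.cons_val_one, div_one]
    nlinarith [Real.sin_sq_add_cos_sq (t - arg2 y)]
  · have hd : (Matrix.diagonal ![M, M ^ (1 - 2 * τ)]).det = (M ^ (1 - τ)) ^ 2 := by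
      rw [Matrix.det_diagonal, Fin.prod_univ_two, ← Real.rpow_natCast, ← Real.rpow_mul hM.le]
      simp only [Matrix.cons_val_zero, Matrix.cons_val_one]
      nth_rewrite 1 [← Real.rpow_one M]
      rw [← Real.rpow_add hM]
      congr 1
      push_cast; ring
    have h1 : M = M ^ τ * M ^ (1 - τ) := by
      rw [← Real.rpow_add hM]; simp
    have h2 : M ^ (1 - 2 * τ) = (M ^ τ)⁻¹ * M ^ (1 - τ) := by
      rw [← Real.rpow_neg hM.le, ← Real.rpow_add hM]; congr 1; ring
    have hpos : 0 < M ^ (1 - τ) := Real.rpow_pos_of_pos hM _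
    rw [hd, Real.sqrt_sq hpos.le, div_eq_iff hpos.ne']
    simp only [quad, dot2, Matrix.mulVec_diagonal, Matrix.cons_val_zero, Matrix.cons_val_one]
    rw [h2]
    nth_rewrite 1 [h1]
    ring

lemma ftau_eq {M : ℝ} (hM : 0 < M) (τ : ℝ) (x : V2) (ρ : ℝ) :
    ftau M τ x ρ = (1 / (2 * π)) * ∫ t in (0 : ℝ)..(2 * π),
      normalEnergy (M ^ τ) (cM M τ * π / 2) (arg2 (x + ρ • eit t)) t := by
  simp only [ftau, quad_Atau_div_sqrt_det hM]

lemma eit_periodic : Function.Periodic eit (2 * π) := fun t => by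
  simp [eit]

lemma normalEnergy_periodic (μ a : ℝ) (x : V2) (ρ : ℝ) :
    Function.Periodic (fun t => normalEnergy μ a (arg2 (x + ρ • eit t)) t) (2 * π) := fun t => by
  simp only [eit_periodic t, normalEnergy, add_sub_right_comm, Real.cos_add_two_pi,
    Real.sin_add_two_pi]

lemma integral_normalEnergy_origin (μ : ℝ) {a : ℝ} (ha : 0 ≤ a) (ha' : a ≤ π) :
    ∫ t in (0 : ℝ)..(2 * π), normalEnergy μ a (arg2 ((0 : V2) + (1 : ℝ) • eit t)) t =
      2 * a + μ * (2 * (π - a)) := by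
  have hpi := Real.pi_pos
  have key : ∀ {b d k : ℝ}, b ≤ d → 0 ≤ b → d ≤ 2 * π →
      (∀ t ∈ Ico b d, normalEnergy μ a t t = k) →
      IntervalIntegrable (fun t => normalEnergy μ a (arg2 ((0 : V2) + (1 : ℝ) • eit t)) t)
        volume b d ∧
      ∫ t in b..d, normalEnergy μ a (arg2 ((0 : V2) + (1 : ℝ) • eit t)) t = (d - b) * k := by
    intro b d k hbd hb hd hk
    have hcongr : ∀ t ∈ Ioo b d,
        (fun _ => k) t = normalEnergy μ a (arg2 ((0 : V2) + (1 : ℝ) • eit t)) t := by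
      intro t ht
      rw [zero_add, one_smul, arg2_eit ⟨by linarith [ht.1], by linarith [ht.2]⟩,
        hk t ⟨ht.1.le, ht.2⟩]
    constructor
    · rw [intervalIntegrable_iff_integrableOn_Ioo_of_le hbd]
      exact IntegrableOn.congr_fun (by simp) hcongr measurableSet_Ioo
    · rw [intervalIntegral.integral_of_le hbd, integral_Ioc_eq_integral_Ioo,
        ← setIntegral_congr_fun measurableSet_Ioo hcongr]
      simp [hbd]
  have hin : ∀ t ∈ Ico 0 a ∪ Ico π (π + a), normalEnergy μ a t t = 1 := fun t ht => if_pos ht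
  have hout : ∀ t ∉ Ico 0 a ∪ Ico π (π + a), normalEnergy μ a t t = μ := fun t ht => by
    rw [normalEnergy, if_neg ht]; simp
  obtain ⟨i1, e1⟩ := key ha le_rfl (by linarith) fun t ht => hin t (Or.inl ht)
  obtain ⟨i2, e2⟩ := key ha' ha (by linarith) fun t ht => hout t (by
    rintro (h | h)
    · linarith [h.2, ht.1]
    · linarith [h.1, ht.2])
  obtain ⟨i3, e3⟩ := key (b := π) (d := π + a) (by linarith) hpi.le (by linarith)
    fun t ht => hin t (Or.inr ht)
  obtain ⟨i4, e4⟩ := key (b := π + a) (d := 2 * π) (by linarith) (by linarith) le_rfl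
    fun t ht => hout t (by
      rintro (h | h)
      · linarith [h.2, ht.1]
      · linarith [h.2, ht.1])
  rw [← intervalIntegral.integral_add_adjacent_intervals ((i1.trans i2).trans i3) i4,
    ← intervalIntegral.integral_add_adjacent_intervals (i1.trans i2) i3,
    ← intervalIntegral.integral_add_adjacent_intervals i1 i2, e1, e2, e3, e4]
  ring

/-- The angle `t` with `e^{it}` on the ray of angle `φ` issued from the point `-(p, q)` of the
closed unit disc. -/
def exitAngle (p q φ : ℝ) : ℝ := φ + Real.arcsin (p * Real.sin φ - q * Real.cos φ)

lemma exitAngle_add_pi (p q φ : ℝ) :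
    exitAngle p q (φ + π) = φ + π - Real.arcsin (p * Real.sin φ - q * Real.cos φ) := by
  rw [exitAngle, Real.sin_add_pi, Real.cos_add_pi, sub_eq_add_neg (φ + π), ← Real.arcsin_neg]
  congr 2; ring

lemma exitAngle_add_two_pi (p q φ : ℝ) : exitAngle p q (φ + 2 * π) = exitAngle p q φ + 2 * π := by
  rw [exitAngle, exitAngle, Real.sin_add_two_pi, Real.cos_add_two_pi]; ring

lemma exitAngle_monotone_of_lt {p q : ℝ} (h : p ^ 2 + q ^ 2 < 1) : Monotone (exitAngle p q) := by
  have hbound : ∀ φ : ℝ, (p * Real.sin φ - q * Real.cos φ) ^ 2 +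
      (p * Real.cos φ + q * Real.sin φ) ^ 2 = p ^ 2 + q ^ 2 := fun φ => by
    linear_combination (p ^ 2 + q ^ 2) * Real.sin_sq_add_cos_sq φ
  have hder : ∀ φ : ℝ, HasDerivAt (exitAngle p q)
      (1 + 1 / Real.sqrt (1 - (p * Real.sin φ - q * Real.cos φ) ^ 2) *
        (p * Real.cos φ - q * -Real.sin φ)) φ := by
    intro φ
    have hne1 : p * Real.sin φ - q * Real.cos φ ≠ -1 := fun h1 => by
      have := hbound φ
      rw [h1] at this
      nlinarith [sq_nonneg (p * Real.cos φ + q * Real.sin φ)]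
    have hne2 : p * Real.sin φ - q * Real.cos φ ≠ 1 := fun h1 => by
      have := hbound φ
      rw [h1] at this
      nlinarith [sq_nonneg (p * Real.cos φ + q * Real.sin φ)]
    have hinner : HasDerivAt (fun φ => p * Real.sin φ - q * Real.cos φ)
        (p * Real.cos φ - q * -Real.sin φ) φ :=
      ((Real.hasDerivAt_sin φ).const_mul p).sub ((Real.hasDerivAt_cos φ).const_mul q)
    exact (hasDerivAt_id φ).add (HasDerivAt.comp (h₂ := Real.arcsin)
      (h := fun φ => p * Real.sin φ - q * Real.cos φ) φ (Real.hasDerivAt_arcsin hne1 hne2) hinner)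
  refine monotone_of_deriv_nonneg (fun φ => (hder φ).differentiableAt) fun φ => ?_
  rw [(hder φ).deriv]
  set D := Real.sqrt (1 - (p * Real.sin φ - q * Real.cos φ) ^ 2)
  have hpos : 0 < 1 - (p * Real.sin φ - q * Real.cos φ) ^ 2 := by
    nlinarith [hbound φ, sq_nonneg (p * Real.cos φ + q * Real.sin φ)]
  have hD : 0 < D := Real.sqrt_pos.mpr hpos
  have habs : |p * Real.cos φ + q * Real.sin φ| ≤ D :=
    Real.abs_le_sqrt (by linarith [hbound φ])
  have hge := (abs_le.mp habs).1
  have : 1 + 1 / D * (p * Real.cos φ - q * -Real.sin φ) =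
      (D + (p * Real.cos φ + q * Real.sin φ)) / D := by
    field_simp; ring
  rw [this]
  exact div_nonneg (by linarith) hD.le

lemma exitAngle_monotone {p q : ℝ} (h : p ^ 2 + q ^ 2 ≤ 1) : Monotone (exitAngle p q) := by
  intro φ ψ hle
  have hlim : ∀ θ : ℝ, Filter.Tendsto (fun r : ℝ => exitAngle (r * p) (r * q) θ)
      (nhdsWithin 1 (Ioo 0 1)) (nhds (exitAngle p q θ)) := by
    intro θ
    have hc : Continuous fun r : ℝ => exitAngle (r * p) (r * q) θ := by
      unfold exitAngle
      exact continuous_const.add (Real.continuous_arcsin.comp (by fun_prop))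
    simpa using (hc.tendsto 1).mono_left nhdsWithin_le_nhds
  have : (nhdsWithin (1 : ℝ) (Ioo 0 1)).NeBot := right_nhdsWithin_Ioo_neBot one_pos
  refine le_of_tendsto_of_tendsto (hlim φ) (hlim ψ) ?_
  filter_upwards [self_mem_nhdsWithin] with r hr
  refine exitAngle_monotone_of_lt ?_ hle
  nlinarith [hr.1, hr.2, sq_nonneg p, sq_nonneg q, mul_pos hr.1 hr.1]

lemma eq_exitAngle_add {p q s φ t : ℝ} (hs : 0 < s) (h : p ^ 2 + q ^ 2 ≤ 1)
    (hc : s * Real.cos φ = p + Real.cos t) (hd : s * Real.sin φ = q + Real.sin t) :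
    ∃ n : ℤ, t = exitAngle p q φ + n * (2 * π) := by
  have hφ := Real.sin_sq_add_cos_sq φ
  have ht := Real.sin_sq_add_cos_sq t
  have hct : Real.cos t = s * Real.cos φ - p := by linarith
  have hst : Real.sin t = s * Real.sin φ - q := by linarith
  have hsin : Real.sin (t - φ) = p * Real.sin φ - q * Real.cos φ := by
    rw [Real.sin_sub, hct, hst]; ring
  have hcos : Real.cos (t - φ) = s - p * Real.cos φ - q * Real.sin φ := by
    rw [Real.cos_sub, hct, hst]; linear_combination s * hφ
  have hpos : 0 ≤ Real.cos (t - φ) := by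
    rw [hct, hst] at ht
    have h2 : 2 * s * Real.cos (t - φ) = s ^ 2 + 1 - (p ^ 2 + q ^ 2) := by
      rw [hcos]; linear_combination ht - s ^ 2 * hφ
    by_contra hneg
    push Not at hneg
    nlinarith
  have h1 : Real.cos (t - φ - Real.arcsin (p * Real.sin φ - q * Real.cos φ)) = 1 := by
    rw [← hsin, Real.cos_sub, Real.cos_arcsin, Real.sin_arcsin (Real.neg_one_le_sin _)
      (Real.sin_le_one _), ← Real.abs_cos_eq_sqrt_one_sub_sin_sq, abs_of_nonneg hpos]
    linarith [Real.sin_sq_add_cos_sq (t - φ)]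
  obtain ⟨n, hn⟩ := (Real.cos_eq_one_iff _).mp h1
  exact ⟨n, by rw [exitAngle]; linarith⟩

lemma polar_scaled (x : V2) {ρ : ℝ} (hρ : 0 < ρ) (t : ℝ) :
    ∃ s : ℝ, 0 ≤ s ∧ s * Real.cos (arg2 (x + ρ • eit t)) = x 0 / ρ + Real.cos t ∧
      s * Real.sin (arg2 (x + ρ • eit t)) = x 1 / ρ + Real.sin t ∧
      (s = 0 → arg2 (x + ρ • eit t) = 0) := by
  obtain ⟨s, hs, h0, h1, -, hz⟩ := arg2_polar (x + ρ • eit t)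
  have e0 : (x + ρ • eit t) 0 = x 0 + ρ * Real.cos t := rfl
  have e1 : (x + ρ • eit t) 1 = x 1 + ρ * Real.sin t := rfl
  rw [e0] at h0
  rw [e1] at h1
  refine ⟨s / ρ, by positivity, ?_, ?_, fun h => hz (by simpa [hρ.ne'] using h)⟩
  · field_simp; linarith
  · field_simp; linarith

lemma arg2_mem (y : V2) : arg2 y ∈ Ico 0 (2 * π) := by
  obtain ⟨-, -, -, -, h, -⟩ := arg2_polar y
  exact h

lemma normalEnergy_le {μ : ℝ} (hμ : 1 ≤ μ) (a φ t : ℝ) : normalEnergy μ a φ t ≤ μ := by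
  unfold normalEnergy
  split_ifs
  · exact hμ
  · have : μ⁻¹ ≤ μ := (inv_le_one_of_one_le₀ hμ).trans hμ
    nlinarith [Real.sin_sq_add_cos_sq (t - φ), sq_nonneg (Real.sin (t - φ))]

lemma integral_normalEnergy_le_of_inside {μ a : ℝ} (hμ : 1 ≤ μ) (ha : 0 < a) (ha' : a ≤ π)
    (x : V2) {ρ : ℝ} (hρ : 0 < ρ) (hx : (x 0 / ρ) ^ 2 + (x 1 / ρ) ^ 2 ≤ 1) :
    ∫ t in (0 : ℝ)..(2 * π), normalEnergy μ a (arg2 (x + ρ • eit t)) t ≤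
      2 * π + (μ - 1) * (2 * (π - a)) := by
  have hpi := Real.pi_pos
  set T := exitAngle (x 0 / ρ) (x 1 / ρ) with hT
  have hmono : Monotone T := exitAngle_monotone hx
  have hT2 : T (2 * π) = T 0 + 2 * π := by
    have := exitAngle_add_two_pi (x 0 / ρ) (x 1 / ρ) 0
    rwa [zero_add] at this
  set g₁ : ℝ → ℝ := (Icc (T a) (T π)).indicator fun _ => μ - 1 with hg₁
  set g₂ : ℝ → ℝ := (Icc (T (π + a)) (T (2 * π))).indicator fun _ => μ - 1 with hg₂
  have g₁0 : ∀ t, 0 ≤ g₁ t := fun t => indicator_nonneg (fun _ _ => by linarith) t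
  have g₂0 : ∀ t, 0 ≤ g₂ t := fun t => indicator_nonneg (fun _ _ => by linarith) t
  have i₁ : Integrable g₁ volume :=
    (integrable_indicator_iff measurableSet_Icc).mpr (by simp)
  have i₂ : Integrable g₂ volume :=
    (integrable_indicator_iff measurableSet_Icc).mpr (by simp)
  have hle : ∀ t ∈ Ioo (T 0) (T 0 + 2 * π),
      normalEnergy μ a (arg2 (x + ρ • eit t)) t ≤ 1 + g₁ t + g₂ t := by
    intro t ht
    set φ := arg2 (x + ρ • eit t) with hφ
    by_cases hgood : φ ∈ Ico 0 a ∪ Ico π (π + a)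
    · rw [normalEnergy, if_pos hgood]; linarith [g₁0 t, g₂0 t]
    have hφm : φ ∈ Ico 0 (2 * π) := arg2_mem _
    obtain ⟨s, hs, hc, hd, hz⟩ := polar_scaled x hρ t
    have hs' : 0 < s := by
      refine lt_of_le_of_ne hs fun h0 => hgood (Or.inl ?_)
      rw [hφ, hz h0.symm]
      exact ⟨le_rfl, ha⟩
    obtain ⟨n, hn⟩ := eq_exitAngle_add hs' hx hc hd
    have hl : T 0 ≤ T φ := hmono hφm.1
    have hu : T φ ≤ T (2 * π) := hmono hφm.2.le
    rw [← hT, ← hφ] at hn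
    have hn0 : n = 0 := by
      have h1 : (n : ℝ) < 1 := by
        by_contra hcon; push Not at hcon
        nlinarith [ht.2]
      have h2 : (-1 : ℝ) < n := by
        by_contra hcon; push Not at hcon
        nlinarith [ht.1]
      have h1' : n < 1 := by exact_mod_cast h1
      have h2' : -1 < n := by exact_mod_cast h2
      omega
    have htT : t = T φ := by rw [hn, hn0]; simp
    have hub := normalEnergy_le hμ a φ t
    by_cases hφπ : φ < π
    · have haφ : a ≤ φ := by
        by_contra hcon; push Not at hcon
        exact hgood (Or.inl ⟨hφm.1, hcon⟩)
      have : g₁ t = μ - 1 :=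
        indicator_of_mem (by rw [htT]; exact ⟨hmono haφ, hmono hφπ.le⟩) _
      linarith [g₂0 t]
    · push Not at hφπ
      have haφ : π + a ≤ φ := by
        by_contra hcon; push Not at hcon
        exact hgood (Or.inr ⟨hφπ, hcon⟩)
      have : g₂ t = μ - 1 :=
        indicator_of_mem (by rw [htT]; exact ⟨hmono haφ, hu⟩) _
      linarith [g₁0 t]
  have hper := (normalEnergy_periodic μ a x ρ).intervalIntegral_add_eq 0 (T 0)
  rw [zero_add] at hper
  rw [hper, intervalIntegral.integral_of_le (by linarith), integral_Ioc_eq_integral_Ioo]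
  have j₀ : IntegrableOn (fun _ : ℝ => (1 : ℝ)) (Ioo (T 0) (T 0 + 2 * π)) volume :=
    integrableOn_const measure_Ioo_lt_top.ne
  have j₁ : IntegrableOn (fun t => 1 + g₁ t) (Ioo (T 0) (T 0 + 2 * π)) volume :=
    j₀.add i₁.integrableOn
  have e₁ : ∫ t in Ioo (T 0) (T 0 + 2 * π), g₁ t ≤ (μ - 1) * (T π - T a) := by
    refine (setIntegral_le_integral i₁ (ae_of_all _ g₁0)).trans_eq ?_
    rw [hg₁, integral_indicator_const _ measurableSet_Icc,
      Real.volume_real_Icc_of_le (hmono ha'), smul_eq_mul, mul_comm]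
  have e₂ : ∫ t in Ioo (T 0) (T 0 + 2 * π), g₂ t ≤ (μ - 1) * (T (2 * π) - T (π + a)) := by
    refine (setIntegral_le_integral i₂ (ae_of_all _ g₂0)).trans_eq ?_
    rw [hg₂, integral_indicator_const _ measurableSet_Icc,
      Real.volume_real_Icc_of_le (hmono (by linarith)), smul_eq_mul, mul_comm]
  calc ∫ t in Ioo (T 0) (T 0 + 2 * π), normalEnergy μ a (arg2 (x + ρ • eit t)) t
      ≤ ∫ t in Ioo (T 0) (T 0 + 2 * π), (1 + g₁ t + g₂ t) := by
        refine integral_mono_of_nonneg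
          (ae_of_all _ fun t => normalEnergy_nonneg (by linarith) _ _ _)
          (j₁.add i₂.integrableOn) ?_
        exact (ae_restrict_mem measurableSet_Ioo).mono hle
    _ = 2 * π + (∫ t in Ioo (T 0) (T 0 + 2 * π), g₁ t) +
          ∫ t in Ioo (T 0) (T 0 + 2 * π), g₂ t := by
        rw [integral_add j₁ i₂.integrableOn,
          integral_add j₀ i₁.integrableOn]
        simp [hpi.le]
    _ ≤ 2 * π + (μ - 1) * (2 * (π - a)) := by
        have hTa : T (π + a) = a + π - (T a - a) := by
          rw [hT, add_comm, exitAngle_add_pi, exitAngle]; ring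
        have hTpi : T π = π - (T 0 - 0) := by
          have := exitAngle_add_pi (x 0 / ρ) (x 1 / ρ) 0
          rw [zero_add] at this
          rw [hT, this, exitAngle]; ring
        have : (μ - 1) * (T π - T a) + (μ - 1) * (T (2 * π) - T (π + a)) =
            (μ - 1) * (2 * (π - a)) := by
          rw [hTa, hTpi, hT2]; ring
        linarith

lemma normalEnergy_le_cos_pow_four {μ : ℝ} (hμ : 1 ≤ μ) (a φ t : ℝ) :
    normalEnergy μ a φ t ≤ 1 + (μ - 1) * (Real.cos (t - φ) ^ 4 + (1 - μ⁻¹)) := by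
  have h0 : 0 < μ⁻¹ := by positivity
  have h1 : μ⁻¹ ≤ 1 := inv_le_one_of_one_le₀ hμ
  unfold normalEnergy
  split_ifs
  · have : 0 ≤ (μ - 1) * (Real.cos (t - φ) ^ 4 + (1 - μ⁻¹)) :=
      mul_nonneg (by linarith) (add_nonneg (by positivity) (by linarith))
    linarith
  · rw [Real.sin_sq]
    set C := Real.cos (t - φ) ^ 2 with hC
    have hC0 : 0 ≤ C := sq_nonneg _
    have h4 : Real.cos (t - φ) ^ 4 = C ^ 2 := by rw [hC]; ring
    have hinv : μ * μ⁻¹ = 1 := mul_inv_cancel₀ (by linarith)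
    have hdiff : 1 + (μ - 1) * (C ^ 2 + (1 - μ⁻¹)) - (μ * C + μ⁻¹ * (1 - C)) =
        (μ - 1) * ((C - 1) ^ 2 + C * (1 - μ⁻¹)) := by
      linear_combination (C - 1) * hinv
    have : 0 ≤ (μ - 1) * ((C - 1) ^ 2 + C * (1 - μ⁻¹)) :=
      mul_nonneg (by linarith) (add_nonneg (sq_nonneg _) (mul_nonneg hC0 (by linarith)))
    rw [h4]
    linarith

/-- On the unit circle this is `e^{2iβ}`, where `β` is the angle between `z` and `z + X`. -/
def doubledAngle (X z : ℂ) : ℂ := z * (1 + (starRingEnd ℂ) X * z) / (z + X)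

lemma doubledAngle_circleMap {X : ℂ} {s φ t : ℝ} (hs : s ≠ 0)
    (h : circleMap 0 1 t + X = s * Complex.exp (φ * Complex.I)) :
    doubledAngle X (circleMap 0 1 t) = Complex.exp ((2 * (t - φ) : ℝ) * Complex.I) := by
  have hz : circleMap 0 1 t = Complex.exp (t * Complex.I) := by simp [circleMap]
  have hX : X = s * Complex.exp (φ * Complex.I) - Complex.exp (t * Complex.I) := by
    rw [← h, hz]; ring
  have hconj : ∀ u : ℝ, (starRingEnd ℂ) (Complex.exp (u * Complex.I)) =
      (Complex.exp (u * Complex.I))⁻¹ := fun u => by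
    rw [← Complex.exp_conj, ← Complex.exp_neg]; simp
  have hsC : (s : ℂ) ≠ 0 := by exact_mod_cast hs
  have hexp : Complex.exp ((2 * (t - φ) : ℝ) * Complex.I) =
      Complex.exp (t * Complex.I) ^ 2 * (Complex.exp (φ * Complex.I) ^ 2)⁻¹ := by
    rw [← Complex.exp_nat_mul, ← Complex.exp_nat_mul, ← Complex.exp_neg, ← Complex.exp_add]
    congr 1
    push_cast; ring
  have ht := Complex.exp_ne_zero (t * Complex.I)
  have hφ := Complex.exp_ne_zero (φ * Complex.I)
  rw [doubledAngle, h, hexp, hX, map_sub, map_mul, hconj, hconj, Complex.conj_ofReal, hz]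
  field_simp
  ring

lemma cos_pow_four_eq (β : ℝ) : Real.cos β ^ 4 = 3 / 8 +
    (Complex.exp ((2 * β : ℝ) * Complex.I) / 2 +
      Complex.exp ((2 * β : ℝ) * Complex.I) ^ 2 / 8).re := by
  have h2 : Complex.exp ((2 * β : ℝ) * Complex.I) ^ 2 =
      Complex.exp ((2 * (2 * β) : ℝ) * Complex.I) := by
    rw [← Complex.exp_nat_mul]; congr 1; push_cast; ring
  have hre : ∀ u : ℝ, (Complex.exp (u * Complex.I)).re = Real.cos u :=
    Complex.exp_ofReal_mul_I_re
  have d2 : ∀ w : ℂ, (w / 2).re = w.re / 2 := fun w => by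
    rw [show (2 : ℂ) = ((2 : ℝ) : ℂ) by norm_num, Complex.div_ofReal_re]
  have d8 : ∀ w : ℂ, (w / 8).re = w.re / 8 := fun w => by
    rw [show (8 : ℂ) = ((8 : ℝ) : ℂ) by norm_num, Complex.div_ofReal_re]
  rw [h2, Complex.add_re, d2, d8, hre, hre, Real.cos_two_mul (2 * β), Real.cos_two_mul β]
  ring

lemma integral_doubledAngle {X : ℂ} (hX : 1 < ‖X‖) :
    Continuous (fun t : ℝ => (doubledAngle X (circleMap 0 1 t) / 2 +
      doubledAngle X (circleMap 0 1 t) ^ 2 / 8).re) ∧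
    ∫ t in (0 : ℝ)..(2 * π), (doubledAngle X (circleMap 0 1 t) / 2 +
      doubledAngle X (circleMap 0 1 t) ^ 2 / 8).re = 0 := by
  have hne : ∀ z ∈ Metric.closedBall (0 : ℂ) 1, z + X ≠ 0 := by
    intro z hz h0
    rw [mem_closedBall_zero_iff] at hz
    rw [eq_neg_of_add_eq_zero_right h0, norm_neg] at hX
    linarith
  have hd : DifferentiableOn ℂ (doubledAngle X) (Metric.closedBall 0 1) := by
    unfold doubledAngle
    exact DifferentiableOn.div (by fun_prop) (by fun_prop) hne
  have hF : DifferentiableOn ℂ (fun z => doubledAngle X z / 2 + doubledAngle X z ^ 2 / 8)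
      (Metric.closedBall 0 1) :=
    (hd.div_const 2).add ((hd.pow 2).div_const 8)
  have hcont : Continuous fun t : ℝ => doubledAngle X (circleMap 0 1 t) / 2 +
      doubledAngle X (circleMap 0 1 t) ^ 2 / 8 :=
    hF.continuousOn.comp_continuous (continuous_circleMap 0 1)
      fun t => circleMap_mem_closedBall 0 zero_le_one t
  refine ⟨Complex.continuous_re.comp hcont, ?_⟩
  have hdc : DiffContOnCl ℂ (fun z => doubledAngle X z / 2 + doubledAngle X z ^ 2 / 8)
      (Metric.ball 0 |1|) := by
    rw [abs_one]
    exact DifferentiableOn.diffContOnCl (by rwa [closure_ball _ one_ne_zero])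
  have hav := hdc.circleAverage
  have hzero : doubledAngle X 0 = 0 := by simp [doubledAngle]
  rw [Real.circleAverage_def, hzero] at hav
  have hint : ∫ t in (0 : ℝ)..(2 * π), (doubledAngle X (circleMap 0 1 t) / 2 +
      doubledAngle X (circleMap 0 1 t) ^ 2 / 8) = 0 := by
    simpa [Real.pi_ne_zero] using hav
  have := Complex.reCLM.intervalIntegral_comp_comm (hcont.intervalIntegrable (μ := volume) 0 (2 * π))
  simpa [hint] using this

lemma integral_normalEnergy_le_of_outside {μ : ℝ} (hμ : 1 ≤ μ) (a : ℝ)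
    (x : V2) {ρ : ℝ} (hρ : 0 < ρ) (hx : 1 < (x 0 / ρ) ^ 2 + (x 1 / ρ) ^ 2) :
    ∫ t in (0 : ℝ)..(2 * π), normalEnergy μ a (arg2 (x + ρ • eit t)) t ≤
      2 * π * (1 + (μ - 1) * (3 / 8 + (1 - μ⁻¹))) := by
  set X : ℂ := ⟨x 0 / ρ, x 1 / ρ⟩ with hXdef
  have hX : 1 < ‖X‖ := by
    rw [← Real.sqrt_one, Complex.norm_eq_sqrt_sq_add_sq]
    exact Real.sqrt_lt_sqrt zero_le_one hx
  obtain ⟨hcont, hint⟩ := integral_doubledAngle hX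
  set F : ℝ → ℝ := fun t => (doubledAngle X (circleMap 0 1 t) / 2 +
      doubledAngle X (circleMap 0 1 t) ^ 2 / 8).re with hF
  have hle : ∀ t, normalEnergy μ a (arg2 (x + ρ • eit t)) t ≤
      (1 + (μ - 1) * (3 / 8 + (1 - μ⁻¹))) + (μ - 1) * F t := by
    intro t
    obtain ⟨s, -, hc, hd, -⟩ := polar_scaled x hρ t
    set φ := arg2 (x + ρ • eit t)
    have hs : s ≠ 0 := by
      rintro rfl
      have h0 : x 0 / ρ = -Real.cos t := by linarith
      have h1 : x 1 / ρ = -Real.sin t := by linarith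
      rw [h0, h1] at hx
      nlinarith [Real.sin_sq_add_cos_sq t]
    have h : circleMap 0 1 t + X = s * Complex.exp (φ * Complex.I) := by
      apply Complex.ext
      · rw [Complex.re_ofReal_mul, Complex.exp_ofReal_mul_I_re, hc]
        simp [circleMap, Complex.exp_ofReal_mul_I_re, hXdef, add_comm]
      · rw [Complex.im_ofReal_mul, Complex.exp_ofReal_mul_I_im, hd]
        simp [circleMap, Complex.exp_ofReal_mul_I_im, hXdef, add_comm]
    refine (normalEnergy_le_cos_pow_four hμ a φ t).trans_eq ?_
    rw [cos_pow_four_eq, ← doubledAngle_circleMap hs h, hF]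
    ring
  have hpi := Real.two_pi_pos
  have hIcont : Continuous fun t => (1 + (μ - 1) * (3 / 8 + (1 - μ⁻¹))) + (μ - 1) * F t := by
    fun_prop
  calc ∫ t in (0 : ℝ)..(2 * π), normalEnergy μ a (arg2 (x + ρ • eit t)) t
      ≤ ∫ t in (0 : ℝ)..(2 * π), ((1 + (μ - 1) * (3 / 8 + (1 - μ⁻¹))) + (μ - 1) * F t) := by
        rw [intervalIntegral.integral_of_le hpi.le, intervalIntegral.integral_of_le hpi.le]
        exact integral_mono_of_nonneg
          (ae_of_all _ fun t => normalEnergy_nonneg (by linarith) _ _ _)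
          ((intervalIntegrable_iff_integrableOn_Ioc_of_le hpi.le).mp
            (hIcont.intervalIntegrable 0 (2 * π))) (ae_of_all _ hle)
    _ = 2 * π * (1 + (μ - 1) * (3 / 8 + (1 - μ⁻¹))) := by
        rw [intervalIntegral.integral_add (by simp)
          ((hcont.const_mul _).intervalIntegrable _ _), intervalIntegral.integral_const_mul, hint,
          intervalIntegral.integral_const, mul_zero, add_zero, sub_zero, smul_eq_mul]

/-- There exists `m₀ > 1`, independent of `τ` and `M`, such that
`f(x, ρ) ≤ f(0, 1) = 2/(1 + M^{−τ})` for all `x ∈ ℝ²` and `ρ > 0`, provided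
`M ∈ (1, m₀^{1/τ})` if `τ > 0`, with no restriction on `M > 1` if `τ = 0`. -/
theorem stmt8 :
    ∃ m₀ > (1 : ℝ), ∀ M τ : ℝ, 1 < M → 0 ≤ τ → τ ≤ 1 →
      (τ = 0 ∨ M < m₀ ^ (1 / τ)) →
      (∀ x : V2, ∀ ρ : ℝ, 0 < ρ → ftau M τ x ρ ≤ ftau M τ 0 1) ∧
        ftau M τ 0 1 = 2 / (1 + M ^ (-τ)) := by
  refine ⟨11 / 10, by norm_num, fun M τ hM hτ _ hsmall => ?_⟩
  have hM0 : 0 < M := by linarith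
  have hpi := Real.pi_pos
  set μ := M ^ τ with hμdef
  have hμ : 1 ≤ μ := Real.one_le_rpow hM.le hτ
  have hμ' : μ ≤ 11 / 10 := by
    rcases hτ.eq_or_lt with h0 | h0
    · rw [hμdef, ← h0, Real.rpow_zero]; norm_num
    · have hlt := hsmall.resolve_left h0.ne'
      calc M ^ τ ≤ ((11 / 10 : ℝ) ^ (1 / τ)) ^ τ := Real.rpow_le_rpow hM0.le hlt.le hτ
        _ = 11 / 10 := by
          rw [← Real.rpow_mul (by norm_num), one_div_mul_cancel h0.ne', Real.rpow_one]
  have hμ0 : 0 < μ := by linarith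
  have hvalue : 2 / (1 + M ^ (-τ)) = 2 * μ / (1 + μ) := by
    rw [Real.rpow_neg hM0.le, ← hμdef]; field_simp; ring
  have ha : cM M τ * π / 2 = π * μ / (1 + μ) := by
    rw [cM, hvalue]; ring
  have ha0 : 0 < π * μ / (1 + μ) := by positivity
  have haπ : π * μ / (1 + μ) ≤ π := by
    rw [div_le_iff₀ (by positivity)]; nlinarith
  have horigin : ftau M τ 0 1 = 2 * μ / (1 + μ) := by
    rw [ftau_eq hM0, ha, ← hμdef, integral_normalEnergy_origin μ ha0.le haπ]
    field_simp; ring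
  refine ⟨fun x ρ hρ => ?_, horigin.trans hvalue.symm⟩
  rw [horigin, ftau_eq hM0, ha, ← hμdef, one_div_mul_eq_div, div_le_iff₀ (by positivity)]
  rcases le_or_gt ((x 0 / ρ) ^ 2 + (x 1 / ρ) ^ 2) 1 with hx | hx
  · refine (integral_normalEnergy_le_of_inside hμ ha0 haπ x hρ hx).trans_eq ?_
    field_simp; ring
  · refine (integral_normalEnergy_le_of_outside hμ _ x hρ hx).trans ?_
    rw [mul_comm (2 * π)]
    refine mul_le_mul_of_nonneg_right ?_ (by positivity)
    have hkey : 3 / 8 + (1 - μ⁻¹) ≤ 1 / (1 + μ) := by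
      have h1 : (10 / 11 : ℝ) ≤ μ⁻¹ := by
        rw [le_inv_comm₀ (by norm_num) hμ0]; norm_num; linarith
      have h2 : (10 / 21 : ℝ) ≤ 1 / (1 + μ) := by
        rw [le_div_iff₀ (by positivity)]; linarith
      linarith
    calc 1 + (μ - 1) * (3 / 8 + (1 - μ⁻¹)) ≤ 1 + (μ - 1) * (1 / (1 + μ)) := by
          gcongr
      _ = 2 * μ / (1 + μ) := by field_simp; ring
end
end

section
/- Let x ∈ ℝ² with |x| ≥ 1 and define h : ℝ → ℝ by h(t) = cos²( arg(x + e^{it}) − t ) (defined for t with x + e^{it} ≠ 0). Then for every k ∈ [0, 1], the Lebesgue measure of { t ∈ [0, 2π) : h(t) ≤ k } equals 4 arcsin √k. -/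
open MeasureTheory Real Set

noncomputable section

lemma cos_arg2_sub_sq_le_iff {y : V2} (hy : Complex.mk (y 0) (y 1) ≠ 0) (t k : ℝ) :
    Real.cos (arg2 y - t) ^ 2 ≤ k ↔
      (y 0 * Real.cos t + y 1 * Real.sin t) ^ 2 ≤ k * (y 0 ^ 2 + y 1 ^ 2) := by
  have hcos : Real.cos (arg2 y - t) = Real.cos (Complex.arg (Complex.mk (y 0) (y 1)) - t) := by
    unfold arg2
    split_ifs
    · rfl
    · rw [add_sub_right_comm, Real.cos_add_two_pi]
  have hnorm : ‖Complex.mk (y 0) (y 1)‖ ^ 2 = y 0 ^ 2 + y 1 ^ 2 := by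
    rw [Complex.sq_norm, Complex.normSq_mk]; ring
  have hpos : 0 < ‖Complex.mk (y 0) (y 1)‖ := norm_pos_iff.mpr hy
  rw [hcos, Real.cos_sub, Complex.cos_arg hy, Complex.sin_arg, ← hnorm,
    ← div_le_iff₀ (by positivity)]
  have : y 0 / ‖Complex.mk (y 0) (y 1)‖ * Real.cos t + y 1 / ‖Complex.mk (y 0) (y 1)‖ * Real.sin t
      = (y 0 * Real.cos t + y 1 * Real.sin t) / ‖Complex.mk (y 0) (y 1)‖ := by ring
  rw [this, div_pow]

lemma exists_polar_coord (x : V2) :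
    ∃ φ : ℝ, x 0 = ‖x‖ * Real.cos φ ∧ x 1 = ‖x‖ * Real.sin φ := by
  have hnorm : ‖Complex.mk (x 0) (x 1)‖ = ‖x‖ := by
    rw [EuclideanSpace.norm_eq, Complex.norm_def, Complex.normSq_mk]
    simp [Fin.sum_univ_two, sq]
  refine ⟨Complex.arg (Complex.mk (x 0) (x 1)), ?_, ?_⟩
  · rw [← hnorm, Complex.norm_mul_cos_arg]
  · rw [← hnorm, Complex.norm_mul_sin_arg]

/-- The points of a circle of radius `r ≥ 1` about `1` that lie in a double wedge with apex `0` and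
half-angle `β` about the vertical axis. -/
lemma one_add_mul_cos_sq_le_iff {r β γ u : ℝ} (hr : 1 ≤ r) (hβ0 : 0 ≤ β) (hγ0 : 0 ≤ γ)
    (hβγ : β + γ ≤ π / 2) (hγ : r * Real.sin γ = Real.cos β) (hu0 : 0 ≤ u) (huπ : u ≤ π) :
    (1 + r * Real.cos u) ^ 2 ≤ Real.sin β ^ 2 * (1 + 2 * r * Real.cos u + r ^ 2) ↔
      π / 2 - β + γ ≤ u ∧ u ≤ π / 2 + β + γ := by
  have hfac : (1 + r * Real.cos u) ^ 2 - Real.sin β ^ 2 * (1 + 2 * r * Real.cos u + r ^ 2) =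
      r ^ 2 * ((Real.cos u - Real.cos (π / 2 - β + γ)) *
        (Real.cos u - Real.cos (π / 2 + β + γ))) := by
    rw [show π / 2 - β + γ = π / 2 - (β - γ) by ring, Real.cos_pi_div_two_sub,
      show π / 2 + β + γ = (β + γ) + π / 2 by ring, Real.cos_add_pi_div_two, Real.sin_sub,
      Real.sin_add]
    have hsinβ : Real.sin β ^ 2 = 1 - r ^ 2 * Real.sin γ ^ 2 := by
      rw [← mul_pow, hγ, Real.sin_sq]
    have hcosγ : Real.cos γ ^ 2 = 1 - Real.sin γ ^ 2 := Real.cos_sq' γ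
    rw [← hγ]
    linear_combination (-(1 + 2 * r * Real.cos u + r ^ 2) + r ^ 2 * Real.cos γ ^ 2) * hsinβ +
      r ^ 2 * (1 - r ^ 2 * Real.sin γ ^ 2) * hcosγ
  have hπ := Real.pi_pos
  have ha : π / 2 - β + γ ∈ Icc 0 π := ⟨by linarith, by linarith⟩
  have hb : π / 2 + β + γ ∈ Icc 0 π := ⟨by linarith, by linarith⟩
  have hab : Real.cos (π / 2 + β + γ) ≤ Real.cos (π / 2 - β + γ) :=
    Real.strictAntiOn_cos.antitoneOn ha hb (by linarith)
  rw [← Real.strictAntiOn_cos.le_iff_ge ⟨hu0, huπ⟩ ha,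
    ← Real.strictAntiOn_cos.le_iff_ge hb ⟨hu0, huπ⟩, ← sub_nonpos, hfac]
  have hr2 : 0 < r ^ 2 := by positivity
  constructor
  · intro h
    have h' := nonpos_of_mul_nonpos_right h hr2
    rcases mul_nonpos_iff.mp h' with h | h <;> constructor <;> linarith [h.1, h.2]
  · rintro ⟨h1, h2⟩
    exact mul_nonpos_of_nonneg_of_nonpos hr2.le
      (mul_nonpos_of_nonpos_of_nonneg (by linarith) (by linarith))

lemma volume_inter_Ico_eq_of_periodic_s11 {p : ℝ → Prop} (hp : MeasurableSet {u | p u})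
    (hper : Function.Periodic p (2 * π)) (φ : ℝ) :
    volume ({t | p (t - φ)} ∩ Ico 0 (2 * π)) = volume ({u | p u} ∩ Ioc (-π) π) := by
  have hd (a : ℝ) := isAddFundamentalDomain_Ioc Real.two_pi_pos a (volume : Measure ℝ)
  have hm : MeasurableSet {t | p (t - φ)} := hp.preimage (measurable_id.sub_const φ)
  have hT : ∀ g : AddSubgroup.zmultiples (2 * π),
      (fun t : ℝ => g +ᵥ t) ⁻¹' {t | p (t - φ)} = {t | p (t - φ)} := by
    rintro ⟨_, n, rfl⟩
    ext t
    have := hper.int_mul n (t - φ)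
    simp only [mem_preimage, mem_ofPred_eq, AddSubgroup.vadd_def, vadd_eq_add]
    rw [← this]
    simp
    ring_nf
  calc volume ({t | p (t - φ)} ∩ Ico 0 (2 * π))
      = volume ({t | p (t - φ)} ∩ Ioc 0 (0 + 2 * π)) := by
        rw [zero_add]
        exact measure_congr ((Filter.EventuallyEq.refl _ _).inter Ico_ae_eq_Ioc)
    _ = volume ({t | p (t - φ)} ∩ Ioc (φ - π) (φ - π + 2 * π)) :=
        (hd _).measure_set_eq (hd _) hm hT
    _ = volume ((fun t => t - φ) ⁻¹' ({u | p u} ∩ Ioc (-π) π)) := by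
        congr 1
        ext t
        simp only [mem_inter_iff, mem_ofPred_eq, mem_Ioc, mem_preimage]
        refine and_congr_right fun _ => ⟨fun h => ⟨?_, ?_⟩, fun h => ⟨?_, ?_⟩⟩ <;>
          linarith [h.1, h.2]
    _ = volume ({u | p u} ∩ Ioc (-π) π) := by
        simp only [sub_eq_add_neg]
        exact measure_preimage_add_right _ _ _

lemma volume_abs_mem_Icc {a b : ℝ} (ha : 0 ≤ a) (hab : a ≤ b) :
    volume {u : ℝ | |u| ∈ Icc a b} = ENNReal.ofReal (2 * (b - a)) := by
  have hset : {u : ℝ | |u| ∈ Icc a b} = Icc a b ∪ Icc (-b) (-a) := by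
    ext u
    simp only [mem_ofPred_eq, mem_union, mem_Icc]
    rcases abs_cases u with ⟨h, h'⟩ | ⟨h, h'⟩ <;> rw [h] <;> constructor
    · exact Or.inl
    · rintro (h | h)
      · exact h
      · constructor <;> linarith [h.1, h.2]
    · exact fun h => Or.inr ⟨by linarith [h.2], by linarith [h.1]⟩
    · rintro (h | h) <;> constructor <;> linarith [h.1, h.2]
  have hdisj : AEDisjoint volume (Icc a b) (Icc (-b) (-a)) := by
    refine measure_mono_null (t := {0}) ?_ (by simp)
    rintro u ⟨h1, h2⟩
    exact le_antisymm (by linarith [h2.2]) (by linarith [h1.1])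
  rw [hset, measure_union₀ measurableSet_Icc.nullMeasurableSet hdisj, Real.volume_Icc,
    Real.volume_Icc, ← ENNReal.ofReal_add (by linarith) (by linarith)]
  ring_nf

/-- For `|x| ≥ 1` and `h(t) = cos²(arg(x + e^{it}) − t)`, the Lebesgue
measure of `{t ∈ [0, 2π) : h(t) ≤ k}` equals `4 arcsin √k` for every `k ∈ [0, 1]`. -/
theorem stmt11 (x : V2) (hx : 1 ≤ ‖x‖) (k : ℝ) (hk0 : 0 ≤ k) (hk1 : k ≤ 1) :
    volume {t ∈ Ico (0 : ℝ) (2 * π) | Real.cos (arg2 (x + eit t) - t) ^ 2 ≤ k} =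
      ENNReal.ofReal (4 * arcsin (Real.sqrt k)) := by
  obtain ⟨φ, hx0, hx1⟩ := exists_polar_coord x
  set r := ‖x‖
  have hrpos : 0 < r := by linarith
  set β := arcsin √k
  have hsinβ : Real.sin β = √k :=
    Real.sin_arcsin (by linarith [Real.sqrt_nonneg k]) (Real.sqrt_le_one.mpr hk1)
  have hβ0 : 0 ≤ β := Real.arcsin_nonneg.mpr (Real.sqrt_nonneg k)
  have hβ1 : β ≤ π / 2 := Real.arcsin_le_pi_div_two _
  have hcosβ : 0 ≤ Real.cos β := Real.cos_arcsin_nonneg _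
  have hquot : Real.cos β / r ≤ Real.cos β := div_le_self hcosβ hx
  set γ := arcsin (Real.cos β / r)
  have hγ0 : 0 ≤ γ := Real.arcsin_nonneg.mpr (by positivity)
  have hγ : r * Real.sin γ = Real.cos β := by
    rw [Real.sin_arcsin (by linarith [div_nonneg hcosβ hrpos.le])
      (hquot.trans (Real.cos_le_one β))]
    field_simp
  have hβγ : β + γ ≤ π / 2 := by
    have h : γ ≤ arcsin (Real.cos β) := Real.monotone_arcsin hquot
    rw [← Real.sin_pi_div_two_sub, Real.arcsin_sin (by linarith) (by linarith)] at h
    linarith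
  set p : ℝ → Prop := fun u =>
    (1 + r * Real.cos u) ^ 2 ≤ k * (1 + 2 * r * Real.cos u + r ^ 2) with hp
  have hper : Function.Periodic p (2 * π) := fun u => by simp only [hp, Real.cos_add_two_pi]
  have hmeas : MeasurableSet {u | p u} := measurableSet_le (by fun_prop) (by fun_prop)
  have hcount : {t | Real.cos (t - φ) = -1}.Countable := by
    refine (countable_range fun n : ℤ => π + n * (2 * π) + φ).mono fun t ht => ?_
    obtain ⟨n, hn⟩ := (Real.cos_eq_neg_one_iff).mp ht
    exact ⟨n, by simp only [hn, sub_add_cancel]⟩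
  have hae : ({t ∈ Ico (0 : ℝ) (2 * π) | Real.cos (arg2 (x + eit t) - t) ^ 2 ≤ k} : Set ℝ)
      =ᵐ[volume] ({t | p (t - φ)} ∩ Ico 0 (2 * π) : Set ℝ) := by
    filter_upwards [hcount.ae_notMem volume] with t ht
    have e0 : (x + eit t) 0 = r * Real.cos φ + Real.cos t := by simp [eit, toV, hx0]
    have e1 : (x + eit t) 1 = r * Real.sin φ + Real.sin t := by simp [eit, toV, hx1]
    have hφ := Real.sin_sq_add_cos_sq φ
    have hts := Real.sin_sq_add_cos_sq t
    have hlin : (x + eit t) 0 * Real.cos t + (x + eit t) 1 * Real.sin t =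
        1 + r * Real.cos (t - φ) := by
      rw [e0, e1, Real.cos_sub]
      linear_combination hts
    have hsq : (x + eit t) 0 ^ 2 + (x + eit t) 1 ^ 2 =
        1 + 2 * r * Real.cos (t - φ) + r ^ 2 := by
      rw [e0, e1, Real.cos_sub]
      linear_combination hts + r ^ 2 * hφ
    have hne : Complex.mk ((x + eit t) 0) ((x + eit t) 1) ≠ 0 := by
      intro h
      have h0 : (x + eit t) 0 = 0 := congrArg Complex.re h
      have h1 : (x + eit t) 1 = 0 := congrArg Complex.im h
      rw [h0, h1] at hlin hsq
      apply ht
      have hc : r * Real.cos (t - φ) = -1 := by linarith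
      have hr1 : r = 1 := by nlinarith
      simpa [hr1] using hc
    refine propext ?_
    change (t ∈ Ico 0 (2 * π) ∧ Real.cos (arg2 (x + eit t) - t) ^ 2 ≤ k) ↔
      (p (t - φ) ∧ t ∈ Ico 0 (2 * π))
    rw [cos_arg2_sub_sq_le_iff hne, hlin, hsq, and_comm]
  have hset : ({u | p u} ∩ Ioc (-π) π : Set ℝ) =ᵐ[volume]
      ({u | |u| ∈ Icc (π / 2 - β + γ) (π / 2 + β + γ)} : Set ℝ) := by
    filter_upwards [(countable_singleton (-π)).ae_notMem volume] with u hu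
    refine propext ?_
    change (p u ∧ u ∈ Ioc (-π) π) ↔ |u| ∈ Icc (π / 2 - β + γ) (π / 2 + β + γ)
    have hiff (h : |u| ≤ π) :=
      one_add_mul_cos_sq_le_iff hx hβ0 hγ0 hβγ hγ (abs_nonneg u) h
    rw [hsinβ, Real.sq_sqrt hk0, Real.cos_abs] at hiff
    constructor
    · rintro ⟨h, h'⟩
      exact (hiff (abs_le.mpr ⟨h'.1.le, h'.2⟩)).mp h
    · intro h
      have hπ : |u| ≤ π := by linarith [h.2]
      exact ⟨(hiff hπ).mpr h, lt_of_le_of_ne (abs_le.mp hπ).1 (Ne.symm hu), (abs_le.mp hπ).2⟩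
  rw [measure_congr hae, volume_inter_Ico_eq_of_periodic_s11 hmeas hper, measure_congr hset,
    volume_abs_mem_Icc (by linarith) (by linarith)]
  ring_nf
end
end

section
/- There exist ε > 0 and m₀ > 1 such that for every m ∈ (1, m₀]: m/(m+1) ≤ (2/π) arcsin √((1+ε)/(m+1)) − (2ε/(π m)) · ( arcsin √((1+ε)/(m+1)) − arcsin √(1/(m+1)) ). -/
open Real

/-- There exist `ε > 0` and `m₀ > 1` such that for every `m ∈ (1, m₀]`:
`m/(m+1) ≤ (2/π) arcsin √((1+ε)/(m+1)) − (2ε/(πm)) (arcsin √((1+ε)/(m+1)) − arcsin √(1/(m+1)))`. -/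
theorem stmt12 :
    ∃ ε > (0 : ℝ), ∃ m₀ > (1 : ℝ), ∀ m : ℝ, 1 < m → m ≤ m₀ →
      m / (m + 1) ≤
        (2 / π) * arcsin (Real.sqrt ((1 + ε) / (m + 1))) -
          (2 * ε / (π * m)) *
            (arcsin (Real.sqrt ((1 + ε) / (m + 1))) - arcsin (Real.sqrt (1 / (m + 1)))) := by
  have h_left : arcsin √(1 / (1 + 1)) = π / 4 := by
    rw [← arcsin_sin (x := π / 4) (by linarith [pi_pos]) (by linarith [pi_pos]), sin_pi_div_four]
    congr 1
    rw [sqrt_eq_iff_mul_self_eq (by norm_num) (by positivity)]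
    nlinarith [Real.mul_self_sqrt (show (0 : ℝ) ≤ 2 by norm_num)]
  have h_right : arcsin √((1 + 1 / 2) / (1 + 1)) = π / 3 := by
    rw [← arcsin_sin (x := π / 3) (by linarith [pi_pos]) (by linarith [pi_pos]), sin_pi_div_three]
    congr 1
    rw [sqrt_eq_iff_mul_self_eq (by norm_num) (by positivity)]
    nlinarith [Real.mul_self_sqrt (show (0 : ℝ) ≤ 3 by norm_num)]
  -- With `ε = 1 / 2` the inequality is strict at `m = 1`, where it reads `1 / 2 < 7 / 12`.
  have h_strict : (1 : ℝ) / (1 + 1) <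
      (2 / π) * arcsin √((1 + 1 / 2) / (1 + 1)) -
        (2 * (1 / 2) / (π * 1)) *
          (arcsin √((1 + 1 / 2) / (1 + 1)) - arcsin √(1 / (1 + 1))) := by
    rw [h_left, h_right]
    field_simp
    norm_num
  have h_lhs : ContinuousAt (fun m : ℝ => m / (m + 1)) 1 := by
    fun_prop (disch := norm_num)
  have h_rhs : ContinuousAt (fun m : ℝ =>
      (2 / π) * arcsin √((1 + 1 / 2) / (m + 1)) -
        (2 * (1 / 2) / (π * m)) *
          (arcsin √((1 + 1 / 2) / (m + 1)) - arcsin √(1 / (m + 1)))) 1 := by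
    have h_arcsin (c : ℝ) : ContinuousAt (fun m : ℝ => arcsin √(c / (m + 1))) 1 :=
      continuous_arcsin.continuousAt.comp
        (f := fun m : ℝ => √(c / (m + 1))) (by fun_prop (disch := norm_num))
    have h_coeff : ContinuousAt (fun m : ℝ => 2 * (1 / 2) / (π * m)) 1 :=
      continuousAt_const.div (by fun_prop) (by simp [pi_ne_zero])
    exact (continuousAt_const.mul (h_arcsin _)).sub
      (h_coeff.mul ((h_arcsin _).sub (h_arcsin _)))
  obtain ⟨δ, hδ, h_near⟩ := Metric.eventually_nhds_iff.1 (h_lhs.eventually_lt h_rhs h_strict)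
  refine ⟨1 / 2, by norm_num, 1 + δ / 2, by linarith, fun m hm hm₀ => (h_near ?_).le⟩
  rw [Real.dist_eq, abs_lt]
  constructor <;> linarith
end

section
/- For the function ζ(ε, δ) = (2/π)[ arcsin √((1+ε)/(2+δ)) − (ε/(1+δ)) ( arcsin √((1+ε)/(2+δ)) − arcsin √(1/(2+δ)) ) ] − (1+δ)/(2+δ), defined for ε ≥ 0 and δ ≥ 0, one has ζ(0, 0) = 0, and there exist ε₀ > 0 and δ₀ > 0 such that ζ(ε₀, δ) > 0 for all δ ∈ (0, δ₀). -/
open Real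

noncomputable section

/-- The function `ζ(ε, δ)` from the sharpness construction. -/
def zeta (ε δ : ℝ) : ℝ :=
  (2 / π) * (arcsin (Real.sqrt ((1 + ε) / (2 + δ))) -
      (ε / (1 + δ)) * (arcsin (Real.sqrt ((1 + ε) / (2 + δ))) -
        arcsin (Real.sqrt (1 / (2 + δ))))) -
    (1 + δ) / (2 + δ)

lemma arcsin_sqrt_eq_of_sin_sq {x θ : ℝ} (h₀ : 0 ≤ θ) (h₁ : θ ≤ π / 2) (h : sin θ ^ 2 = x) :
    arcsin (Real.sqrt x) = θ := by
  rw [← h, Real.sqrt_sq (sin_nonneg_of_nonneg_of_le_pi h₀ (by linarith [pi_pos])),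
    arcsin_sin (by linarith [pi_pos]) h₁]

lemma arcsin_sqrt_half : arcsin (Real.sqrt (1 / 2)) = π / 4 :=
  arcsin_sqrt_eq_of_sin_sq (by positivity) (by linarith [pi_pos]) (by
    rw [sin_pi_div_four, div_pow, Real.sq_sqrt (by norm_num)]; norm_num)

lemma arcsin_sqrt_three_quarters : arcsin (Real.sqrt (3 / 4)) = π / 3 :=
  arcsin_sqrt_eq_of_sin_sq (by positivity) (by linarith [pi_pos]) (by
    rw [sin_pi_div_three, div_pow, Real.sq_sqrt (by norm_num)]; norm_num)

lemma zeta_zero_zero : zeta 0 0 = 0 := by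
  simp only [zeta, add_zero, zero_div, zero_mul, sub_zero, arcsin_sqrt_half]
  field_simp
  norm_num

lemma zeta_half_zero : zeta (1 / 2) 0 = 1 / 12 := by
  have h : (1 + 1 / 2 : ℝ) / 2 = 3 / 4 := by norm_num
  simp only [zeta, add_zero, h, arcsin_sqrt_half, arcsin_sqrt_three_quarters]
  field_simp
  norm_num

lemma continuousAt_zeta_zero (ε : ℝ) : ContinuousAt (zeta ε) 0 := by
  have h (c : ℝ) : ContinuousAt (fun δ : ℝ => c / (2 + δ)) 0 :=
    continuousAt_const.div (by fun_prop) (by norm_num)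
  have harc (c : ℝ) : ContinuousAt (fun δ : ℝ => arcsin (Real.sqrt (c / (2 + δ)))) 0 :=
    continuous_arcsin.continuousAt.comp (h c).sqrt
  have hε : ContinuousAt (fun δ : ℝ => ε / (1 + δ)) 0 :=
    continuousAt_const.div (by fun_prop) (by norm_num)
  have hlast : ContinuousAt (fun δ : ℝ => (1 + δ) / (2 + δ)) 0 :=
    ContinuousAt.div (by fun_prop) (by fun_prop) (by norm_num)
  exact (continuousAt_const.mul
    ((harc (1 + ε)).sub (hε.mul ((harc (1 + ε)).sub (harc 1))))).sub hlast

/-- `ζ(0,0) = 0`, and there exist `ε₀ > 0`, `δ₀ > 0` such that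
`ζ(ε₀, δ) > 0` for all `δ ∈ (0, δ₀)`. -/
theorem stmt13 :
    zeta 0 0 = 0 ∧
      ∃ ε₀ > (0 : ℝ), ∃ δ₀ > (0 : ℝ), ∀ δ : ℝ, 0 < δ → δ < δ₀ → 0 < zeta ε₀ δ := by
  refine ⟨zeta_zero_zero, 1 / 2, by norm_num, ?_⟩
  have hpos : 0 < zeta (1 / 2) 0 := by rw [zeta_half_zero]; norm_num
  obtain ⟨r, hr, hball⟩ := Metric.eventually_nhds_iff.1
    ((continuousAt_zeta_zero (1 / 2)).eventually_const_lt hpos)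
  refine ⟨r, hr, fun δ hδ hδr => hball ?_⟩
  rwa [Real.dist_eq, sub_zero, abs_of_pos hδ]
end
end
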